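/- arXiv:1705.09251 — 3 statements merged into one kernel-verified Lean document; each statement's English description precedes it below -/
import Mathlib

section
/- There is an absolute constant C > 0 with the following property. Let D and M be coprime positive integers with N := DM ≥ 2, and let x > 1 be a real number. Let S'(D, M, x) be the set of positive integers d satisfying: (i) x < d ≤ 2x; (ii) d is squarefree and d ≡ 3 (mod 4); (iii) for every prime p dividing M, p splits in ℚ(√−d), i.e. if p = 2 then d ≡ 7 (mod 8), and if p is odd then the Legendre symbol (−d/p) equals 1; (iv) for every prime p dividing D, p is inert in ℚ(√−d), i.e. if p = 2 then d ≡ 3 (mod 8), and if p is odd then the Legendre symbol (−d/p) equals −1. Then | #S'(D, M, x) − x / (2^{ω(N)+1} · ζ(2) · ∏_{p | 2N} (1 + 1/p)) | ≤ C · x^{1/2} N^{1/4} (log N)^{1/2}, where the product runs over the distinct primes p dividing 2N. -/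
open Finset Filter Topology

lemma aux_sq_dvd {k b a : ℕ} (ha : Squarefree a) (hb : 0 < b) : k ^ 2 ∣ b ^ 2 * a ↔ k ∣ b := by
  constructor
  · intro h
    have hg : 0 < Nat.gcd k b := Nat.gcd_pos_of_pos_right _ hb
    obtain ⟨g, k', b', hg0, hco, hk, hb'⟩ := Nat.exists_coprime' hg
    subst hk
    subst hb'
    have h1 : k' ^ 2 ∣ b' ^ 2 * a := by
      have : (g ^ 2) * k' ^ 2 ∣ g ^ 2 * (b' ^ 2 * a) := by
        convert h using 1 <;> ring
      exact Nat.dvd_of_mul_dvd_mul_left (by positivity) this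
    have h2 : k' ^ 2 ∣ a := (Nat.Coprime.pow 2 2 hco).dvd_of_dvd_mul_left h1
    have h3 : k' = 1 := by
      have := ha k' (by rw [← sq]; exact h2)
      simpa using this
    subst h3
    simp
  · intro h
    exact (pow_dvd_pow_of_dvd h 2).mul_right a

lemma aux_sqfree_sum (d n : ℕ) (hd : 0 < d) (hn : d < n) :
    (∑ k ∈ (Ioo 0 n).filter (fun k => k ^ 2 ∣ d), (ArithmeticFunction.moebius k : ℤ))
      = if Squarefree d then 1 else 0 := by
  obtain ⟨a, b, ha, hb, hab, hsq⟩ := Nat.sq_mul_squarefree_of_pos hd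
  have h1 : (Ioo 0 n).filter (fun k => k ^ 2 ∣ d) = b.divisors := by
    ext k
    simp only [mem_filter, mem_Ioo, Nat.mem_divisors]
    rw [← hab, aux_sq_dvd hsq hb]
    constructor
    · rintro ⟨_, h⟩
      exact ⟨h, hb.ne'⟩
    · rintro ⟨h, _⟩
      refine ⟨⟨Nat.pos_of_dvd_of_pos h hb, ?_⟩, h⟩
      have : k ≤ b := Nat.le_of_dvd hb h
      nlinarith
  rw [h1]
  have h2 := congrArg (fun f => f b) (ArithmeticFunction.coe_zeta_mul_moebius)
  simp only [ArithmeticFunction.coe_zeta_mul_apply, ArithmeticFunction.one_apply] at h2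
  rw [h2]
  have : b = 1 ↔ Squarefree d := by
    constructor
    · rintro rfl
      rw [← hab]; simpa using hsq
    · intro h
      have := h b (by rw [← hab, sq]; exact dvd_mul_right _ _)
      simpa using this
  simp [this]

lemma aux_sum_min (a E : ℝ) (ha : 0 < a) (hE : 0 < E) (n : ℕ) :
    ∑ k ∈ Ioo 0 n, min (a / (k : ℝ) ^ 2) E ≤ 3 * Real.sqrt (a * E) := by
  set K := Real.sqrt (a / E) with hK
  have hK0 : 0 < K := Real.sqrt_pos.mpr (by positivity)
  have hKE : K * E = Real.sqrt (a * E) := by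
    rw [hK, ← Real.sqrt_sq hE.le, ← Real.sqrt_mul (by positivity)]
    rw [Real.sqrt_sq hE.le]
    congr 1
    field_simp
  have hK2 : K ^ 2 = a / E := Real.sq_sqrt (by positivity)
  have haK : a / K = Real.sqrt (a * E) := by
    rw [← hKE]
    field_simp
    rw [hK2]; field_simp
  have hsub : ∑ k ∈ Ioo 0 n, min (a / (k : ℝ) ^ 2) E ≤
      ∑ k ∈ Ioc 0 ⌊K⌋₊, E + ∑ k ∈ Ioo ⌊K⌋₊ n, a * ((k : ℝ) ^ 2)⁻¹ := by
    calc ∑ k ∈ Ioo 0 n, min (a / (k : ℝ) ^ 2) E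
        ≤ ∑ k ∈ Ioc 0 ⌊K⌋₊ ∪ Ioo ⌊K⌋₊ n, min (a / (k : ℝ) ^ 2) E := by
          apply sum_le_sum_of_subset_of_nonneg
          · intro k hk
            simp only [mem_union, mem_Ioc, mem_Ioo] at hk ⊢
            omega
          · intros; positivity
      _ = ∑ k ∈ Ioc 0 ⌊K⌋₊, min (a / (k : ℝ) ^ 2) E
          + ∑ k ∈ Ioo ⌊K⌋₊ n, min (a / (k : ℝ) ^ 2) E := by
          apply sum_union
          rw [disjoint_left]
          intro k hk hk'
          simp only [mem_Ioc, mem_Ioo] at hk hk'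
          omega
      _ ≤ _ := by
          gcongr with k hk k hk
          · exact min_le_right _ _
          · rw [← div_eq_mul_inv]; exact min_le_left _ _
  have h1 : ∑ k ∈ Ioc 0 ⌊K⌋₊, E ≤ K * E := by
    simp only [sum_const, Nat.card_Ioc, nsmul_eq_mul, Nat.sub_zero]
    gcongr
    exact Nat.floor_le hK0.le
  have h2 : ∑ k ∈ Ioo ⌊K⌋₊ n, a * ((k : ℝ) ^ 2)⁻¹ ≤ 2 * (a / K) := by
    rw [← mul_sum]
    calc a * ∑ k ∈ Ioo ⌊K⌋₊ n, ((k : ℝ) ^ 2)⁻¹ ≤ a * (2 / (⌊K⌋₊ + 1)) := by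
          gcongr; exact sum_Ioo_inv_sq_le _ _
      _ ≤ a * (2 / K) := by
          gcongr
          exact (Nat.lt_floor_add_one K).le
      _ = _ := by ring
  rw [hKE] at h1
  rw [haK] at h2
  linarith

noncomputable def cmu (L : Finset ℕ) (k : ℕ) : ℝ :=
  if ∀ p ∈ L, ¬ p ∣ k then (ArithmeticFunction.moebius k : ℝ) else 0

lemma cmu_abs_le (L : Finset ℕ) (k : ℕ) : |cmu L k| ≤ 1 := by
  unfold cmu
  split_ifs
  · have := ArithmeticFunction.abs_moebius_le_one (n := k)
    exact_mod_cast this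
  · simp

lemma cmu_hasSum (L : Finset ℕ) (hL : ∀ p ∈ L, p.Prime) :
    HasSum (fun k : ℕ => cmu L k / (k : ℝ) ^ 2)
      ((Real.pi ^ 2 / 6)⁻¹ * ∏ p ∈ L, (1 - ((p : ℝ) ^ 2)⁻¹)⁻¹) := by
  set f : ℕ → ℝ := fun k : ℕ => cmu L k / (k : ℝ) ^ 2 with hf
  have hsum : Summable (fun k => ‖f k‖) := by
    refine Summable.of_nonneg_of_le (fun _ => norm_nonneg _) (fun k => ?_)
      (hasSum_zeta_two.summable)
    simp only [hf, norm_div, Real.norm_eq_abs]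
    rw [abs_of_nonneg (by positivity : (0:ℝ) ≤ (k:ℝ)^2)]
    gcongr
    exact cmu_abs_le L k
  have hf0 : f 0 = 0 := by simp [hf]
  have hf1 : f 1 = 1 := by
    have : ∀ p ∈ L, p ≠ 1 := fun p hp => (hL p hp).one_lt.ne'
    simp only [hf, cmu, Nat.dvd_one]
    rw [if_pos this]; simp
  have hmul : ∀ {m n : ℕ}, Nat.Coprime m n → f (m * n) = f m * f n := by
    intro m n hmn
    have hc : cmu L (m * n) = cmu L m * cmu L n := by
      unfold cmu
      have h1 : (∀ p ∈ L, ¬ p ∣ m * n) ↔ (∀ p ∈ L, ¬ p ∣ m) ∧ (∀ p ∈ L, ¬ p ∣ n) := by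
        constructor
        · intro h
          exact ⟨fun p hp hd => h p hp (hd.mul_right _), fun p hp hd => h p hp (hd.mul_left _)⟩
        · rintro ⟨h1, h2⟩ p hp hd
          rcases (hL p hp).dvd_mul.mp hd with h | h
          · exact h1 p hp h
          · exact h2 p hp h
      rw [ArithmeticFunction.isMultiplicative_moebius.map_mul_of_coprime hmn]
      by_cases ha : ∀ p ∈ L, ¬ p ∣ m
      · by_cases hb : ∀ p ∈ L, ¬ p ∣ n
        · rw [if_pos (h1.mpr ⟨ha, hb⟩), if_pos ha, if_pos hb]; push_cast; ring
        · rw [if_neg (fun h => hb (h1.mp h).2), if_neg hb]; ring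
      · rw [if_neg (fun h => ha (h1.mp h).1), if_neg ha]; ring
    simp only [hf, hc]
    push_cast
    rw [mul_pow, mul_div_mul_comm]
  have hE := EulerProduct.eulerProduct_hasProd hf1 hmul hsum hf0
  have hterm : ∀ p : Nat.Primes, ∑' e, f ((p : ℕ) ^ e) =
      if (p : ℕ) ∈ L then 1 else 1 - (((p : ℕ) : ℝ) ^ 2)⁻¹ := by
    intro p
    have hp := p.2
    rw [tsum_eq_sum (s := range 2)]
    · simp only [sum_range_succ, range_zero, sum_empty, pow_zero, pow_one, hf1, zero_add]
      simp only [hf, cmu, ArithmeticFunction.moebius_apply_prime hp]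
      split_ifs with h1 h2 h2
      · exact absurd dvd_rfl (h1 _ h2)
      · push_cast; rw [inv_eq_one_div]; ring
      · simp
      · exfalso
        apply h1
        intro q hq hd
        rw [Nat.prime_dvd_prime_iff_eq (hL q hq) hp] at hd
        exact h2 (hd ▸ hq)
    · intro e he
      simp only [mem_range, not_lt] at he
      simp only [hf, cmu]
      have : ArithmeticFunction.moebius ((p : ℕ) ^ e) = 0 := by
        rw [ArithmeticFunction.moebius_eq_zero_of_not_squarefree]
        intro hs
        have := hs p (by rw [← sq]; exact pow_dvd_pow _ he)
        exact hp.one_lt.ne' (Nat.isUnit_iff.mp this)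
      rw [this]; simp
  simp_rw [hterm] at hE
  let φ : ℕ →*₀ ℝ :=
    { toFun := fun n => ((n : ℝ) ^ 2)⁻¹
      map_zero' := by simp
      map_one' := by simp
      map_mul' := by intro a b; push_cast; rw [mul_pow, mul_inv] }
  have hφs : HasSum φ (Real.pi ^ 2 / 6) := by
    have := hasSum_zeta_two
    simpa [φ] using this
  have hZ := EulerProduct.eulerProduct_completely_multiplicative_hasProd (f := φ)
    (by simpa using hφs.summable.norm)
  rw [hφs.tsum_eq] at hZ
  have hP := hE.mul hZ
  have hlt : ∀ p : ℕ, p.Prime → (0:ℝ) < 1 - ((p : ℝ) ^ 2)⁻¹ := by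
    intro p hp
    have : (2 : ℝ) ≤ p := by exact_mod_cast hp.two_le
    rw [sub_pos]
    apply inv_lt_one_of_one_lt₀
    nlinarith
  have hQ : HasProd (fun p : Nat.Primes => if (p : ℕ) ∈ L then (1 - (((p : ℕ) : ℝ) ^ 2)⁻¹)⁻¹ else 1)
      (∏ p ∈ L, (1 - ((p : ℝ) ^ 2)⁻¹)⁻¹) := by
    have h1 := hasProd_prod_of_ne_finset_one
      (f := fun p : Nat.Primes => if (p : ℕ) ∈ L then (1 - (((p : ℕ) : ℝ) ^ 2)⁻¹)⁻¹ else 1)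
      (L := SummationFilter.unconditional _) (s := L.subtype Nat.Prime) (by
        intro b hb
        rw [if_neg]
        exact fun h => hb (Finset.mem_subtype.mpr h))
    convert h1 using 1
    refine Eq.trans ?_ (Finset.prod_subtype_eq_prod_filter (s := L) (p := Nat.Prime)
      (f := fun p : ℕ => if p ∈ L then (1 - ((p : ℝ) ^ 2)⁻¹)⁻¹ else 1)).symm
    rw [Finset.filter_true_of_mem hL]
    apply Finset.prod_congr rfl
    intro p hp
    rw [if_pos hp]
  have heq : ∀ p : Nat.Primes, (if (p : ℕ) ∈ L then 1 else 1 - (((p : ℕ) : ℝ) ^ 2)⁻¹) * (1 - φ p)⁻¹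
      = if (p : ℕ) ∈ L then (1 - (((p : ℕ) : ℝ) ^ 2)⁻¹)⁻¹ else 1 := by
    intro p
    have := hlt p p.2
    simp only [φ, MonoidWithZeroHom.coe_mk, ZeroHom.coe_mk]
    split_ifs
    · ring
    · exact mul_inv_cancel₀ this.ne'
  simp_rw [heq] at hP
  have hu := hP.unique hQ
  have : (∑' n, f n) = (Real.pi ^ 2 / 6)⁻¹ * ∏ p ∈ L, (1 - ((p : ℝ) ^ 2)⁻¹)⁻¹ := by
    rw [← hu]
    have := Real.pi_pos
    field_simp
  rw [← this]
  exact hsum.of_norm.hasSum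

lemma cmu_tendsto (L : Finset ℕ) (hL : ∀ p ∈ L, p.Prime) :
    Tendsto (fun n : ℕ => ∑ k ∈ Ioo 0 n, cmu L k / (k : ℝ) ^ 2) atTop
      (𝓝 ((Real.pi ^ 2 / 6)⁻¹ * ∏ p ∈ L, (1 - ((p : ℝ) ^ 2)⁻¹)⁻¹)) := by
  have h := (cmu_hasSum L hL).tendsto_sum_nat
  refine h.congr (fun n => ?_)
  symm
  apply sum_subset
  · intro k hk; simp at hk ⊢; omega
  · intro k hk hk'
    have : k = 0 := by simp at hk hk'; omega
    subst this; simp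

lemma sum_range_zmod (n : ℕ) [NeZero n] (G : ZMod n → ℂ) :
    ∑ j ∈ range n, G (j : ZMod n) = ∑ a : ZMod n, G a := by
  refine sum_nbij' (fun j => (j : ZMod n)) (fun a => a.val) ?_ ?_ ?_ ?_ ?_
  · intros; simp
  · intro a _; simpa using ZMod.val_lt a
  · intro j hj; simpa using ZMod.val_cast_of_lt (by simpa using hj)
  · intro a _; simp
  · intros; rfl

noncomputable def ee (q h j : ℕ) : ℂ :=
  Complex.exp (2 * Real.pi * Complex.I * ((h : ℂ) * j) / q)

lemma ee_eq (q h j : ℕ) [NeZero q] :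
    ee q h j = ZMod.stdAddChar ((h : ZMod q) * (j : ZMod q)) := by
  have := ZMod.stdAddChar_coe (N := q) ((h * j : ℕ) : ℤ)
  rw [ee]
  push_cast at this
  rw [this]

noncomputable def ff (σ : ℕ → ℤ) (p m : ℕ) : ℂ :=
  if jacobiSym (-(m : ℤ)) p = σ p then 1 else 0

noncomputable def FF (p : ℕ) (ε : ℤ) [Fact p.Prime] (a : ZMod p) : ℂ :=
  (1 / 2 : ℂ) * ((if a = 0 then 0 else 1) + (ε : ℂ) * ((quadraticChar (ZMod p) (-a) : ℤ) : ℂ))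

lemma ff_eq (σ : ℕ → ℤ) (p : ℕ) [Fact p.Prime] (hσ : σ p = 1 ∨ σ p = -1) (m : ℕ) :
    ff σ p m = FF p (σ p) (m : ZMod p) := by
  unfold ff FF
  rw [← jacobiSym.legendreSym.to_jacobiSym, legendreSym]
  push_cast
  by_cases h : (m : ZMod p) = 0
  · rw [h]
    simp
    rcases hσ with h | h <;> simp [h]
  · have h' : -(m : ZMod p) ≠ 0 := neg_ne_zero.mpr h
    rcases quadraticChar_dichotomy h' with h1 | h1 <;> rcases hσ with h2 | h2 <;>
      rw [h1, h2] <;> simp [h] <;> norm_num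

lemma FF_sum (p : ℕ) (ε : ℤ) [Fact p.Prime] (hp : p ≠ 2) :
    ∑ a : ZMod p, FF p ε a = ((p : ℂ) - 1) / 2 := by
  unfold FF
  rw [← mul_sum, sum_add_distrib, ← mul_sum]
  have h1 : ∑ a : ZMod p, (((quadraticChar (ZMod p) (-a) : ℤ)) : ℂ) = 0 := by
    rw [Fintype.sum_equiv (Equiv.neg (ZMod p)) (fun a => (((quadraticChar (ZMod p) (-a) : ℤ)) : ℂ))
      (fun a => (((quadraticChar (ZMod p) a : ℤ)) : ℂ)) (fun a => by simp)]
    have := quadraticChar_sum_zero (F := ZMod p) (by rwa [ZMod.ringChar_zmod_n])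
    exact_mod_cast this
  have h2 : ∑ a : ZMod p, (if a = 0 then (0:ℂ) else 1) = p - 1 := by
    have : ∀ a : ZMod p, (if a = 0 then (0:ℂ) else 1) = 1 - (if a = 0 then 1 else 0) := by
      intro a; split_ifs <;> simp
    simp_rw [this]
    rw [sum_sub_distrib]
    simp [ZMod.card]
  rw [h1, h2]; ring

lemma FF_gauss (p : ℕ) (ε : ℤ) [Fact p.Prime] (hp : p ≠ 2) (hε : ε = 1 ∨ ε = -1)
    (w : ZMod p) (hw : w ≠ 0) :
    ‖∑ a : ZMod p, FF p ε a * ZMod.stdAddChar (w * a)‖ ≤ (1 + Real.sqrt p) / 2 := by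
  set χ : MulChar (ZMod p) ℂ := (quadraticChar (ZMod p)).ringHomComp (Int.castRingHom ℂ) with hχ
  set ψ : AddChar (ZMod p) ℂ := ZMod.stdAddChar with hψ
  have hprim : ψ.IsPrimitive := ZMod.isPrimitive_stdAddChar p
  have hψw : (AddChar.mulShift ψ w).IsPrimitive := by
    apply AddChar.IsPrimitive.of_ne_one
    exact hprim hw
  have hχ1 : χ ≠ 1 := by
    rw [hχ, MulChar.ringHomComp_ne_one_iff (RingHom.injective_int _)]
    exact quadraticChar_ne_one (by rwa [ZMod.ringChar_zmod_n])
  have hχ2 : χ.IsQuadratic := (quadraticChar_isQuadratic (ZMod p)).comp _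
  have hG := gaussSum_sq hχ1 hχ2 hψw
  have hGn : ‖gaussSum χ (AddChar.mulShift ψ w)‖ = Real.sqrt p := by
    rw [eq_comm, Real.sqrt_eq_iff_mul_self_eq (by positivity) (norm_nonneg _), ← sq, ← norm_pow, hG]
    have : ‖χ (-1)‖ = 1 := by
      have h : χ (-1) ^ 2 = 1 := by rw [← map_pow]; simp
      have h3 : ‖χ (-1)‖ ^ 2 = 1 := by rw [← norm_pow, h]; simp
      exact (pow_eq_one_iff_of_nonneg (norm_nonneg _) two_ne_zero).mp h3
    rw [norm_mul, this]; simp [ZMod.card]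
  have hχn : ‖χ (-1)‖ ≤ 1 := by
    rcases hχ2 (-1) with h | h | h <;> rw [h] <;> simp
  have key : ∑ a : ZMod p, FF p ε a * ψ (w * a) =
      (1 / 2 : ℂ) * (-1 + ε * (χ (-1) * gaussSum χ (AddChar.mulShift ψ w))) := by
    have h0 : ∑ a : ZMod p, ψ (w * a) = 0 := by
      have := AddChar.sum_mulShift w hprim
      simp_rw [mul_comm w]
      rw [this, if_neg hw]; simp
    have h1 : ∑ a : ZMod p, (if a = 0 then (0:ℂ) else 1) * ψ (w * a) = -1 := by
      have : ∀ a : ZMod p, (if a = 0 then (0:ℂ) else 1) * ψ (w * a)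
          = ψ (w * a) - (if a = 0 then 1 else 0) := by
        intro a
        split_ifs with h
        · simp [h]
        · simp
      simp_rw [this]
      rw [sum_sub_distrib, h0]; simp
    have h2 : ∑ a : ZMod p, (((quadraticChar (ZMod p) (-a) : ℤ)) : ℂ) * ψ (w * a)
        = χ (-1) * gaussSum χ (AddChar.mulShift ψ w) := by
      rw [gaussSum, mul_sum]
      apply sum_congr rfl
      intro a _
      rw [← mul_assoc, ← map_mul, neg_one_mul, AddChar.mulShift_apply]
      rfl
    unfold FF
    rw [← h1, ← h2]
    simp only [mul_sum, ← sum_add_distrib]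
    apply sum_congr rfl
    intro a _
    ring
  rw [key, norm_mul]
  have hb : ‖(-1 + ε * (χ (-1) * gaussSum χ (AddChar.mulShift ψ w)) : ℂ)‖ ≤ 1 + Real.sqrt p := by
    refine (norm_add_le _ _).trans ?_
    rw [norm_mul, norm_mul, hGn]
    have h1 : ‖(ε : ℂ)‖ = 1 := by rcases hε with h | h <;> simp [h]
    rw [h1]
    simp only [norm_neg, norm_one, one_mul]
    have := Real.sqrt_nonneg (p : ℝ)
    nlinarith
  have h2 : ‖(1 / 2 : ℂ)‖ = 1 / 2 := by simp
  rw [h2]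
  linarith

lemma ff_local (σ : ℕ → ℤ) (p : ℕ) (hp : p.Prime) (hp2 : p ≠ 2) (hσ : σ p = 1 ∨ σ p = -1)
    (u c h : ℕ) (hu : Nat.Coprime u p) :
    ‖∑ j ∈ range p, ff σ p (u * j + c) * ee p h j‖ ≤
      (1 + Real.sqrt p) / 2 + if p ∣ h then (p : ℝ) / 2 else 0 := by
  have : Fact p.Prime := ⟨hp⟩
  have e1 : ∑ j ∈ range p, ff σ p (u * j + c) * ee p h j
      = ∑ a : ZMod p, FF p (σ p) (u * a + c) * ZMod.stdAddChar ((h : ZMod p) * a) := by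
    rw [← sum_range_zmod p]
    apply sum_congr rfl
    intro j _
    rw [ff_eq σ p hσ, ee_eq]
    push_cast
    rfl
  have hu0 : (u : ZMod p) ≠ 0 := by
    intro h0
    rw [ZMod.natCast_eq_zero_iff] at h0
    exact hp.one_lt.ne' (Nat.eq_one_of_dvd_coprimes hu h0 dvd_rfl)
  have e2 : ∑ a : ZMod p, FF p (σ p) (u * a + c) * ZMod.stdAddChar ((h : ZMod p) * a)
      = ∑ b : ZMod p, FF p (σ p) b * ZMod.stdAddChar ((h : ZMod p) * ((u : ZMod p)⁻¹ * (b - (c : ZMod p)))) := by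
    refine Fintype.sum_equiv ((Equiv.mulLeft₀ (u : ZMod p) hu0).trans (Equiv.addRight (c : ZMod p)))
      _ _ ?_
    intro a
    have hval : ((Equiv.mulLeft₀ (u : ZMod p) hu0).trans (Equiv.addRight (c : ZMod p))) a
        = u * a + c := rfl
    rw [hval, add_sub_cancel_right]
    rw [inv_mul_cancel_left₀ hu0]
  set w : ZMod p := h * (u : ZMod p)⁻¹ with hw
  have e3 : ∑ b : ZMod p, FF p (σ p) b * ZMod.stdAddChar ((h : ZMod p) * ((u : ZMod p)⁻¹ * (b - (c : ZMod p))))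
      = ZMod.stdAddChar (-(w * (c : ZMod p))) * ∑ b : ZMod p, FF p (σ p) b * ZMod.stdAddChar (w * b) := by
    rw [mul_sum]
    apply sum_congr rfl
    intro b _
    have : (h : ZMod p) * ((u : ZMod p)⁻¹ * (b - (c : ZMod p))) = -(w * (c : ZMod p)) + w * b := by rw [hw]; ring
    rw [this, AddChar.map_add_eq_mul]; ring
  rw [e1, e2, e3, norm_mul]
  have hn : ‖(ZMod.stdAddChar (-(w * (c : ZMod p))) : ℂ)‖ = 1 := AddChar.norm_apply _ _
  rw [hn, one_mul]
  split_ifs with hd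
  · have : w = 0 := by
      rw [hw, (ZMod.natCast_eq_zero_iff h p).mpr hd, zero_mul]
    rw [this]
    simp only [zero_mul, AddChar.map_zero_eq_one, mul_one]
    rw [FF_sum p _ hp2]
    have h1 : (1 : ℝ) ≤ p := by exact_mod_cast hp.one_lt.le
    have : ((p : ℂ) - 1) / 2 = (((p : ℝ) - 1) / 2 : ℝ) := by push_cast; rfl
    rw [this, Complex.norm_real, Real.norm_eq_abs, abs_of_nonneg (by linarith)]
    have := Real.sqrt_nonneg (p : ℝ)
    linarith
  · rw [add_zero]
    apply FF_gauss p _ hp2 hσ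
    rw [hw]
    apply mul_ne_zero _ (inv_ne_zero hu0)
    rwa [Ne, ZMod.natCast_eq_zero_iff]

lemma ff_local_zero (σ : ℕ → ℤ) (p : ℕ) (hp : p.Prime) (hp2 : p ≠ 2) (hσ : σ p = 1 ∨ σ p = -1)
    (u c : ℕ) (hu : Nat.Coprime u p) :
    ∑ j ∈ range p, ff σ p (u * j + c) = ((p : ℂ) - 1) / 2 := by
  have : Fact p.Prime := ⟨hp⟩
  have e1 : ∑ j ∈ range p, ff σ p (u * j + c)
      = ∑ a : ZMod p, FF p (σ p) (u * a + c) := by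
    rw [← sum_range_zmod p]
    apply sum_congr rfl
    intro j _
    rw [ff_eq σ p hσ]
    push_cast
    rfl
  have hu0 : (u : ZMod p) ≠ 0 := by
    intro h0
    rw [ZMod.natCast_eq_zero_iff] at h0
    exact hp.one_lt.ne' (Nat.eq_one_of_dvd_coprimes hu h0 dvd_rfl)
  rw [e1, ← FF_sum p (σ p) hp2]
  refine Fintype.sum_equiv ((Equiv.mulLeft₀ (u : ZMod p) hu0).trans (Equiv.addRight (c : ZMod p)))
      _ _ ?_
  intro a
  simp

lemma ff_congr (σ : ℕ → ℤ) (p m m' : ℕ) (h : m ≡ m' [MOD p]) : ff σ p m = ff σ p m' := by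
  unfold ff
  have : jacobiSym (-(m : ℤ)) p = jacobiSym (-(m' : ℤ)) p := by
    rw [jacobiSym.mod_left, jacobiSym.mod_left (-(m' : ℤ))]
    have h1 : (m : ℤ) ≡ m' [ZMOD p] := (Int.natCast_modEq_iff).mpr h
    have h2 : -(m : ℤ) ≡ -m' [ZMOD p] := h1.neg
    rw [h2]
  rw [this]

lemma crt_sum (m n : ℕ) (hm : 0 < m) (hn : 0 < n) (hmn : Nat.Coprime m n) (F : ℕ → ℂ)
    (hF : ∀ j, F (j % (m * n)) = F j) :
    ∑ j ∈ range (m * n), F j = ∑ b ∈ range m, ∑ c ∈ range n, F (n * b + m * c) := by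
  rw [← sum_product']
  symm
  have hinj : Set.InjOn (fun x : ℕ × ℕ => (n * x.1 + m * x.2) % (m * n))
      (range m ×ˢ range n : Finset (ℕ × ℕ)) := by
    rintro ⟨b, c⟩ h1 ⟨b', c'⟩ h2 h
    simp only [coe_product, Set.mem_prod, mem_coe, mem_range] at h1 h2
    have h3 : n * b + m * c ≡ n * b' + m * c' [MOD (m * n)] := h
    have h4 : n * b + m * c ≡ n * b' + m * c' [MOD m] := h3.of_mul_right n
    have h5 : n * b + m * c ≡ n * b' + m * c' [MOD n] := h3.of_mul_left m
    have h6 : n * b ≡ n * b' [MOD m] := by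
      have ha : n * b + m * c ≡ n * b + 0 [MOD m] := Nat.ModEq.add_left _ (by simp [Nat.ModEq])
      have hb : n * b' + m * c' ≡ n * b' + 0 [MOD m] := Nat.ModEq.add_left _ (by simp [Nat.ModEq])
      exact (ha.symm.trans h4).trans hb
    have h7 : m * c ≡ m * c' [MOD n] := by
      have ha : n * b + m * c ≡ 0 + m * c [MOD n] := Nat.ModEq.add_right _ (by simp [Nat.ModEq])
      have hb : n * b' + m * c' ≡ 0 + m * c' [MOD n] := Nat.ModEq.add_right _ (by simp [Nat.ModEq])
      simpa using (ha.symm.trans h5).trans hb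
    have h8 : b ≡ b' [MOD m] := Nat.ModEq.cancel_left_of_coprime hmn h6
    have h9 : c ≡ c' [MOD n] := Nat.ModEq.cancel_left_of_coprime hmn.symm h7
    rw [Prod.mk.injEq]
    exact ⟨Nat.ModEq.eq_of_lt_of_lt h8 h1.1 h2.1, Nat.ModEq.eq_of_lt_of_lt h9 h1.2 h2.2⟩
  have himg : (range m ×ˢ range n).image (fun x : ℕ × ℕ => (n * x.1 + m * x.2) % (m * n))
      = range (m * n) := by
    apply eq_of_subset_of_card_le
    · intro y hy
      simp only [mem_image, mem_range] at hy ⊢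
      obtain ⟨x, _, rfl⟩ := hy
      exact Nat.mod_lt _ (by positivity)
    · rw [card_image_of_injOn hinj]; simp
  rw [← himg, sum_image hinj]
  apply sum_congr rfl
  intro x _
  rw [hF]

lemma ee_mod (q h j : ℕ) (hq : 0 < q) : ee q h (j % q) = ee q h j := by
  have : NeZero q := ⟨hq.ne'⟩
  rw [ee_eq, ee_eq]; simp

lemma ee_crt (m n h b c : ℕ) (hm : 0 < m) (hn : 0 < n) :
    ee (m * n) h (n * b + m * c) = ee m h b * ee n h c := by
  unfold ee
  rw [← Complex.exp_add]
  congr 1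
  have : (m : ℂ) ≠ 0 := by exact_mod_cast hm.ne'
  have : (n : ℂ) ≠ 0 := by exact_mod_cast hn.ne'
  push_cast
  field_simp

lemma ee_zero (q j : ℕ) : ee q 0 j = 1 := by simp [ee]

lemma prod_pos_primes (s : Finset ℕ) (hs : ∀ p ∈ s, p.Prime) : 0 < ∏ p ∈ s, p :=
  prod_pos (fun p hp => (hs p hp).pos)

lemma ff_periodic (σ : ℕ → ℤ) (s : Finset ℕ) (u c j j' q : ℕ) (hq : ∀ p ∈ s, p ∣ q)
    (h : j ≡ j' [MOD q]) :
    ∏ p ∈ s, ff σ p (u * j + c) = ∏ p ∈ s, ff σ p (u * j' + c) := by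
  apply prod_congr rfl
  intro p hp
  apply ff_congr
  exact Nat.ModEq.add_right _ (Nat.ModEq.mul_left _ (h.of_dvd (hq p hp)))

lemma ff_step (σ : ℕ → ℤ) (s : Finset ℕ) (hs : ∀ p ∈ s, p.Prime) (q : ℕ) (hq : q.Prime)
    (hqs : q ∉ s) (u c h : ℕ) :
    ∑ j ∈ range ((∏ p ∈ s, p) * q), (ff σ q (u * j + c) * ∏ p ∈ s, ff σ p (u * j + c)) *
        ee ((∏ p ∈ s, p) * q) h j
      = (∑ b ∈ range (∏ p ∈ s, p), (∏ p ∈ s, ff σ p ((u * q) * b + c)) * ee (∏ p ∈ s, p) h b) *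
        ∑ b ∈ range q, ff σ q ((u * (∏ p ∈ s, p)) * b + c) * ee q h b := by
  have hQ : 0 < ∏ p ∈ s, p := prod_pos_primes s hs
  have hco : Nat.Coprime (∏ p ∈ s, p) q := by
    apply Nat.Coprime.prod_left
    intro p hp
    exact (Nat.coprime_primes (hs p hp) hq).mpr (fun h => hqs (h ▸ hp))
  set Q := ∏ p ∈ s, p with hQdef
  have hdvd : ∀ p ∈ s, p ∣ Q := fun p hp => dvd_prod_of_mem _ hp
  rw [crt_sum Q q hQ hq.pos hco]
  · rw [sum_mul_sum]
    apply sum_congr rfl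
    intro b _
    apply sum_congr rfl
    intro d _
    rw [ee_crt _ _ _ _ _ hQ hq.pos]
    have h1 : ff σ q (u * (q * b + Q * d) + c) = ff σ q (u * Q * d + c) := by
      apply ff_congr
      apply Nat.ModEq.add_right
      have : u * (q * b + Q * d) = q * (u * b) + u * Q * d := by ring
      rw [this]
      simp [Nat.ModEq]
    have h2 : ∏ p ∈ s, ff σ p (u * (q * b + Q * d) + c) = ∏ p ∈ s, ff σ p (u * q * b + c) := by
      have : u * q * b + c = u * (q * b) + c := by ring
      rw [this]
      apply ff_periodic σ s u c _ _ Q hdvd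
      simp [Nat.ModEq]
    rw [h1, h2]; ring
  · intro j
    have h0 : j % (Q * q) ≡ j [MOD (Q * q)] := Nat.mod_modEq _ _
    rw [ee_mod _ _ _ (Nat.mul_pos hQ hq.pos)]
    congr 1
    rw [ff_periodic σ s u c _ _ (Q * q) (fun p hp => (hdvd p hp).mul_right _) h0]
    congr 1
    apply ff_congr
    exact Nat.ModEq.add_right _ (Nat.ModEq.mul_left _ (h0.of_dvd (Dvd.intro_left _ rfl)))

noncomputable def WW (s : Finset ℕ) (h : ℕ) : ℝ :=
  ∏ p ∈ s, ((1 + Real.sqrt p) / 2 + if p ∣ h then (p : ℝ) / 2 else 0)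

lemma ff_bound (σ : ℕ → ℤ) (hσ : ∀ p, σ p = 1 ∨ σ p = -1) (c h : ℕ) (s : Finset ℕ)
    (hs : ∀ p ∈ s, p.Prime ∧ p ≠ 2) :
    ∀ u : ℕ, (∀ p ∈ s, Nat.Coprime u p) →
    ‖∑ j ∈ range (∏ p ∈ s, p), (∏ p ∈ s, ff σ p (u * j + c)) * ee (∏ p ∈ s, p) h j‖ ≤ WW s h := by
  induction s using Finset.induction_on with
  | empty => intro u _; simp [WW, ee]
  | insert q s hq ih =>
    intro u hu
    have hs' : ∀ p ∈ s, p.Prime ∧ p ≠ 2 := fun p hp => hs p (mem_insert_of_mem hp)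
    have hqp := hs q (mem_insert_self _ _)
    have hcop : ∀ p ∈ s, Nat.Coprime q p := fun p hp =>
      (Nat.coprime_primes hqp.1 (hs' p hp).1).mpr (fun h => hq (h ▸ hp))
    have := ff_step σ s (fun p hp => (hs' p hp).1) q hqp.1 hq u c h
    simp only [prod_insert hq]
    rw [mul_comm q, this, norm_mul, WW, prod_insert hq, mul_comm]
    gcongr
    · apply ff_local σ q hqp.1 hqp.2 (hσ q)
      apply Nat.Coprime.mul_left (hu q (mem_insert_self _ _))
      exact Nat.Coprime.prod_left (fun p hp => (hcop p hp).symm)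
    · apply ih hs'
      intro p hp
      exact Nat.Coprime.mul_left (hu p (mem_insert_of_mem hp)) (hcop p hp)

lemma ff_zero (σ : ℕ → ℤ) (hσ : ∀ p, σ p = 1 ∨ σ p = -1) (c : ℕ) (s : Finset ℕ)
    (hs : ∀ p ∈ s, p.Prime ∧ p ≠ 2) :
    ∀ u : ℕ, (∀ p ∈ s, Nat.Coprime u p) →
    ∑ j ∈ range (∏ p ∈ s, p), (∏ p ∈ s, ff σ p (u * j + c)) = ∏ p ∈ s, (((p : ℂ) - 1) / 2) := by
  induction s using Finset.induction_on with
  | empty => intro u _; simp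
  | insert q s hq ih =>
    intro u hu
    have hs' : ∀ p ∈ s, p.Prime ∧ p ≠ 2 := fun p hp => hs p (mem_insert_of_mem hp)
    have hqp := hs q (mem_insert_self _ _)
    have hcop : ∀ p ∈ s, Nat.Coprime q p := fun p hp =>
      (Nat.coprime_primes hqp.1 (hs' p hp).1).mpr (fun h => hq (h ▸ hp))
    have := ff_step σ s (fun p hp => (hs' p hp).1) q hqp.1 hq u c 0
    simp only [ee_zero, mul_one] at this
    simp only [prod_insert hq]
    rw [mul_comm q, this, mul_comm]
    congr 1
    · apply ff_local_zero σ q hqp.1 hqp.2 (hσ q)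
      apply Nat.Coprime.mul_left (hu q (mem_insert_self _ _))
      exact Nat.Coprime.prod_left (fun p hp => (hcop p hp).symm)
    · apply ih hs'
      intro p hp
      exact Nat.Coprime.mul_left (hu p (mem_insert_of_mem hp)) (hcop p hp)

lemma fourier_inv (Q : ℕ) (hQ : 0 < Q) (G : ℕ → ℂ) (hG : ∀ j, G (j % Q) = G j) (j : ℕ) :
    ∑ h ∈ range Q, (∑ i ∈ range Q, G i * ee Q h i) * (ee Q h j)⁻¹ = Q * G j := by
  have : NeZero Q := ⟨hQ.ne'⟩
  have hinv : ∀ h : ℕ, (ee Q h j)⁻¹ = ZMod.stdAddChar (-((h : ZMod Q) * (j : ZMod Q))) := by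
    intro h; rw [ee_eq, AddChar.map_neg_eq_inv]
  have hswap : ∑ h ∈ range Q, (∑ i ∈ range Q, G i * ee Q h i) * (ee Q h j)⁻¹
      = ∑ i ∈ range Q, G i * ∑ h ∈ range Q,
          (fun a : ZMod Q => (ZMod.stdAddChar (a * ((i : ZMod Q) - (j : ZMod Q))) : ℂ)) (h : ZMod Q) := by
    simp_rw [sum_mul, mul_sum]
    rw [sum_comm]
    apply sum_congr rfl
    intro i _
    apply sum_congr rfl
    intro h _
    rw [hinv, ee_eq, mul_assoc, ← AddChar.map_add_eq_mul]
    congr 2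
    ring_nf
  rw [hswap]
  have hin : ∀ i : ℕ, ∑ h ∈ range Q,
          (fun a : ZMod Q => (ZMod.stdAddChar (a * ((i : ZMod Q) - (j : ZMod Q))) : ℂ)) (h : ZMod Q)
      = if i % Q = j % Q then (Q : ℂ) else 0 := by
    intro i
    refine (sum_range_zmod Q
      (fun a : ZMod Q => (ZMod.stdAddChar (a * ((i : ZMod Q) - (j : ZMod Q))) : ℂ))).trans ?_
    rw [AddChar.sum_mulShift _ (ZMod.isPrimitive_stdAddChar Q)]
    simp only [sub_eq_zero, ZMod.natCast_eq_natCast_iff', ZMod.card]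
    split_ifs <;> simp
  simp_rw [hin]
  rw [sum_eq_single (j % Q)]
  · simp only [Nat.mod_mod, if_true]
    rw [hG]; ring
  · intro i hi hne
    rw [Nat.mod_eq_of_lt (by simpa using hi), if_neg hne]; simp
  · intro h
    exact absurd (mem_range.mpr (Nat.mod_lt _ hQ)) h

lemma ee_geom (Q h J : ℕ) (h0 : 0 < h) (hQ : h < Q) :
    ‖∑ j ∈ range J, (ee Q h j)⁻¹‖ ≤ (Q : ℝ) * (1 / 2 * (1 / (h : ℝ) + 1 / ((Q - h : ℕ) : ℝ))) := by
  have hQ0 : (0 : ℝ) < Q := by exact_mod_cast (h0.trans hQ)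
  have hh0 : (0 : ℝ) < h := by exact_mod_cast h0
  have hQh : (0 : ℝ) < (Q - h : ℕ) := by exact_mod_cast Nat.sub_pos_of_lt hQ
  have hcast : ((Q - h : ℕ) : ℝ) = (Q : ℝ) - h := by rw [Nat.cast_sub hQ.le]
  set θ : ℝ := -(2 * Real.pi * h / Q) with hθ
  set z : ℂ := Complex.exp (Complex.I * θ) with hz
  have hpow : ∀ j, (ee Q h j)⁻¹ = z ^ j := by
    intro j
    rw [ee, ← Complex.exp_neg, hz, ← Complex.exp_nat_mul, hθ]
    congr 1
    push_cast
    ring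
  simp_rw [hpow]
  have hnz : ‖z‖ = 1 := by
    rw [hz, mul_comm]; exact Complex.norm_exp_ofReal_mul_I θ
  have hsin : ∀ t : ℝ, 0 < t → t ≤ Q - t → 2 * (t / Q) ≤ Real.sin (Real.pi * t / Q) := by
    intro t ht htQ
    have := Real.mul_le_sin (x := Real.pi * t / Q) (by have := Real.pi_pos; positivity)
      (by
        rw [div_le_div_iff₀ hQ0 (by norm_num)]
        have := Real.pi_pos
        nlinarith)
    convert this using 1
    have := Real.pi_pos
    field_simp
  have hz1 : ‖z - 1‖ = 2 * Real.sin (Real.pi * h / Q) := by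
    rw [hz, Complex.norm_exp_I_mul_ofReal_sub_one, hθ]
    have : -(2 * Real.pi * h / Q) / 2 = -(Real.pi * h / Q) := by ring
    rw [this, Real.sin_neg, Real.norm_eq_abs, mul_neg, abs_neg, abs_of_nonneg]
    have : 0 ≤ Real.sin (Real.pi * h / Q) := by
      apply Real.sin_nonneg_of_nonneg_of_le_pi
      · have := Real.pi_pos; positivity
      · rw [div_le_iff₀ hQ0]
        have h3 : (h : ℝ) ≤ Q := by exact_mod_cast hQ.le
        have := Real.pi_pos
        nlinarith
    linarith
  have hmin : ∃ t : ℝ, 0 < t ∧ 2 * (t / Q) ≤ Real.sin (Real.pi * h / Q) ∧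
      1 / t ≤ 1 / (h : ℝ) + 1 / ((Q - h : ℕ) : ℝ) := by
    rcases le_total (h : ℝ) (Q - h) with hle | hle
    · refine ⟨h, hh0, hsin h hh0 hle, ?_⟩
      have : 0 < 1 / ((Q - h : ℕ) : ℝ) := by positivity
      linarith
    · refine ⟨(Q - h : ℕ), hQh, ?_, ?_⟩
      · have := hsin ((Q - h : ℕ) : ℝ) hQh (by rw [hcast]; linarith)
        refine this.trans (le_of_eq ?_)
        rw [← Real.sin_pi_sub]
        congr 1
        rw [hcast]
        field_simp
        ring
      · have : 0 < 1 / (h : ℝ) := by positivity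
        linarith
  obtain ⟨t, ht, hts, htt⟩ := hmin
  have hlow : 4 * (t / Q) ≤ ‖z - 1‖ := by rw [hz1]; linarith
  have hpos : 0 < ‖z - 1‖ := lt_of_lt_of_le (by positivity) hlow
  have hne : z ≠ 1 := fun h => by rw [h] at hpos; simp at hpos
  rw [geom_sum_eq hne, norm_div]
  have hnum : ‖z ^ J - 1‖ ≤ 2 := by
    refine (norm_sub_le _ _).trans ?_
    rw [norm_pow, hnz]; norm_num
  calc ‖z ^ J - 1‖ / ‖z - 1‖ ≤ 2 / (4 * (t / Q)) := by gcongr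
    _ = Q * (1 / 2 * (1 / t)) := by field_simp; norm_num
    _ ≤ _ := by gcongr

lemma completion (Q : ℕ) (hQ : 0 < Q) (G : ℕ → ℂ) (hG : ∀ j, G (j % Q) = G j) (W : ℕ → ℝ)
    (hW : ∀ h, ‖∑ i ∈ range Q, G i * ee Q h i‖ ≤ W h)
    (hsymm : ∀ h, 0 < h → h < Q → W (Q - h) = W h) (J : ℕ) :
    ‖∑ j ∈ range J, G j - (J : ℂ) / Q * ∑ i ∈ range Q, G i‖ ≤ ∑ h ∈ Ioo 0 Q, W h / h := by
  have hQ0 : (Q : ℂ) ≠ 0 := by exact_mod_cast hQ.ne'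
  have hQr : (0 : ℝ) < Q := by exact_mod_cast hQ
  have h1 : ∑ j ∈ range J, G j = (Q : ℂ)⁻¹ * ∑ h ∈ range Q, (∑ i ∈ range Q, G i * ee Q h i) *
      ∑ j ∈ range J, (ee Q h j)⁻¹ := by
    simp_rw [mul_sum (s := range J)]
    rw [sum_comm]
    simp_rw [fourier_inv Q hQ G hG]
    rw [← mul_sum]
    field_simp
  have hr : range Q = insert 0 (Ioo 0 Q) := by
    ext k; simp; omega
  have h2 : ∑ j ∈ range J, G j - (J : ℂ) / Q * ∑ i ∈ range Q, G i =
      (Q : ℂ)⁻¹ * ∑ h ∈ Ioo 0 Q, (∑ i ∈ range Q, G i * ee Q h i) *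
      ∑ j ∈ range J, (ee Q h j)⁻¹ := by
    rw [h1]
    have : ∑ h ∈ range Q, (∑ i ∈ range Q, G i * ee Q h i) * ∑ j ∈ range J, (ee Q h j)⁻¹
      = (∑ i ∈ range Q, G i) * J + ∑ h ∈ Ioo 0 Q, (∑ i ∈ range Q, G i * ee Q h i) *
      ∑ j ∈ range J, (ee Q h j)⁻¹ := by
      conv_lhs => rw [hr, sum_insert (by simp)]
      rw [← hr]
      simp [ee_zero]
    rw [this]
    field_simp
    ring
  rw [h2, norm_mul]
  have h3 : ‖(Q : ℂ)⁻¹‖ = (Q : ℝ)⁻¹ := by simp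
  rw [h3]
  have h4 : ‖∑ h ∈ Ioo 0 Q, (∑ i ∈ range Q, G i * ee Q h i) * ∑ j ∈ range J, (ee Q h j)⁻¹‖
      ≤ ∑ h ∈ Ioo 0 Q, W h * ((Q : ℝ) * (1 / 2 * (1 / (h : ℝ) + 1 / ((Q - h : ℕ) : ℝ)))) := by
    refine norm_sum_le_of_le _ (fun h hh => ?_)
    rw [mem_Ioo] at hh
    rw [norm_mul]
    have := hW h
    have h0 : 0 ≤ W h := (norm_nonneg _).trans this
    gcongr
    exact ee_geom Q h J hh.1 hh.2
  have h5 : ∑ h ∈ Ioo 0 Q, W h / ((Q - h : ℕ) : ℝ) = ∑ h ∈ Ioo 0 Q, W h / (h : ℝ) := by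
    refine sum_nbij' (fun h => Q - h) (fun h => Q - h) ?_ ?_ ?_ ?_ ?_
    · intro h hh; simp only [mem_Ioo] at hh ⊢; omega
    · intro h hh; simp only [mem_Ioo] at hh ⊢; omega
    · intro h hh; simp only [mem_Ioo] at hh ⊢; omega
    · intro h hh; simp only [mem_Ioo] at hh ⊢; omega
    · intro h hh
      simp only [mem_Ioo] at hh ⊢
      rw [hsymm h hh.1 hh.2]
  calc _ ≤ (Q : ℝ)⁻¹ * ∑ h ∈ Ioo 0 Q, W h * ((Q : ℝ) * (1 / 2 * (1 / (h : ℝ) + 1 / ((Q - h : ℕ) : ℝ)))) := by gcongr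
    _ = ∑ h ∈ Ioo 0 Q, (1 / 2 * (W h / h) + 1 / 2 * (W h / ((Q - h : ℕ) : ℝ))) := by
      rw [mul_sum]
      apply sum_congr rfl
      intro h _
      field_simp
    _ = _ := by
      rw [sum_add_distrib, ← mul_sum, ← mul_sum, h5]; ring

lemma WW_nonneg (s : Finset ℕ) (h : ℕ) : 0 ≤ WW s h := by
  unfold WW
  apply prod_nonneg
  intro p _
  split_ifs <;> positivity

lemma WW_sum (s : Finset ℕ) (hs : ∀ p ∈ s, p.Prime) : ∀ n : ℕ,
    ∑ h ∈ Ioo 0 n, WW s h / h ≤ (∏ p ∈ s, (1 + Real.sqrt p / 2)) * ∑ h ∈ Ioo 0 n, 1 / (h : ℝ) := by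
  induction s using Finset.induction_on with
  | empty => intro n; simp [WW]
  | insert q s hq ih =>
    intro n
    have hs' : ∀ p ∈ s, p.Prime := fun p hp => hs p (mem_insert_of_mem hp)
    have hqp := hs q (mem_insert_self _ _)
    have hq0 : (0 : ℝ) < q := by exact_mod_cast hqp.pos
    have ih' := ih hs'
    set P := ∏ p ∈ s, (1 + Real.sqrt p / 2) with hP
    have hP0 : 0 ≤ P := prod_nonneg (fun p _ => by positivity)
    have h1 : ∑ h ∈ Ioo 0 n, WW (insert q s) h / h =
        (1 + Real.sqrt q) / 2 * ∑ h ∈ Ioo 0 n, WW s h / h +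
        (q : ℝ) / 2 * ∑ h ∈ (Ioo 0 n).filter (fun h => q ∣ h), WW s h / h := by
      rw [sum_filter, mul_sum, mul_sum, ← sum_add_distrib]
      apply sum_congr rfl
      intro h _
      rw [WW, prod_insert hq, ← WW]
      split_ifs <;> ring
    have h2 : ∑ h ∈ (Ioo 0 n).filter (fun h => q ∣ h), WW s h / h ≤
        (q : ℝ)⁻¹ * ∑ h ∈ Ioo 0 n, WW s h / h := by
      have hinj : Set.InjOn (fun k => q * k) (Ioo 0 n : Finset ℕ) :=
        fun a _ b _ h => Nat.eq_of_mul_eq_mul_left hqp.pos h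
      calc ∑ h ∈ (Ioo 0 n).filter (fun h => q ∣ h), WW s h / h
          ≤ ∑ h ∈ (Ioo 0 n).image (fun k => q * k), WW s h / h := by
            apply sum_le_sum_of_subset_of_nonneg
            · intro h hh
              simp only [mem_filter, mem_Ioo, mem_image] at hh ⊢
              obtain ⟨⟨a, b⟩, k, rfl⟩ := hh
              have := hqp.pos
              refine ⟨k, ⟨Nat.pos_of_mul_pos_left a, ?_⟩, rfl⟩
              nlinarith
            · intro h _ _
              have := WW_nonneg s h
              positivity
        _ = ∑ k ∈ Ioo 0 n, WW s (q * k) / (q * k : ℕ) := sum_image hinj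
        _ = _ := by
          rw [mul_sum]
          apply sum_congr rfl
          intro k _
          have : WW s (q * k) = WW s k := by
            unfold WW
            apply prod_congr rfl
            intro p hp
            have : p ∣ q * k ↔ p ∣ k := by
              constructor
              · intro h
                exact Nat.Coprime.dvd_of_dvd_mul_left ((Nat.coprime_primes (hs' p hp) hqp).mpr
                  (fun h => hq (h ▸ hp))) h
              · intro h; exact h.mul_left _
            simp only [this]
          rw [this]; push_cast
          field_simp
    rw [h1, prod_insert hq, ← hP]
    have h3 := ih' n
    calc _ ≤ (1 + Real.sqrt q) / 2 * ∑ h ∈ Ioo 0 n, WW s h / h +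
        (q : ℝ) / 2 * ((q : ℝ)⁻¹ * ∑ h ∈ Ioo 0 n, WW s h / h) := by gcongr
      _ = (1 + Real.sqrt q / 2) * ∑ h ∈ Ioo 0 n, WW s h / h := by field_simp; ring
      _ ≤ (1 + Real.sqrt q / 2) * (P * ∑ h ∈ Ioo 0 n, 1 / (h : ℝ)) := by gcongr
      _ = _ := by ring

lemma prod_sqrt_le (s : Finset ℕ) (hs : ∀ p ∈ s, p.Prime ∧ p ≠ 2) :
    ∏ p ∈ s, (1 + Real.sqrt p / 2) ≤ 2 * Real.sqrt ((∏ p ∈ s, p : ℕ) : ℝ) := by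
  have h1 : ∏ p ∈ s, (1 + Real.sqrt p / 2) ≤ ∏ p ∈ s, ((if p = 3 then 2 else 1) * Real.sqrt p) := by
    apply Finset.prod_le_prod
    · intros; positivity
    · intro p hp
      split_ifs with h
      · subst h
        have : (1 : ℝ) ≤ Real.sqrt (3 : ℕ) := by
          rw [Real.one_le_sqrt]; norm_num
        generalize Real.sqrt (3 : ℕ) = r at this ⊢
        linarith
      · have h4 : 4 ≤ p := by
          have := (hs p hp).1.two_le
          have := (hs p hp).2
          omega
        have : (2 : ℝ) ≤ Real.sqrt p := by
          apply Real.le_sqrt_of_sq_le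
          have : (4 : ℝ) ≤ p := by exact_mod_cast h4
          linarith
        linarith
  refine h1.trans ?_
  rw [prod_mul_distrib, Nat.cast_prod, Real.sqrt_prod _ (fun p _ => by positivity)]
  gcongr
  rw [prod_ite_eq' s 3 (fun _ => (2 : ℝ))]
  split_ifs <;> norm_num

lemma harm_le (n N : ℕ) (hn : n ≤ N) (hN : 2 ≤ N) :
    ∑ h ∈ Ioo 0 n, 1 / (h : ℝ) ≤ 3 * Real.log N := by
  have h1 : ∑ h ∈ Ioo 0 n, 1 / (h : ℝ) ≤ 1 + Real.log N := by
    refine le_trans ?_ (harmonic_le_one_add_log N)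
    rw [harmonic_eq_sum_Icc]
    push_cast
    simp_rw [one_div]
    apply sum_le_sum_of_subset_of_nonneg
    · intro k hk; simp at hk ⊢; omega
    · intros; positivity
  have h2 : Real.log 2 ≤ Real.log N := by
    apply Real.log_le_log (by norm_num); exact_mod_cast hN
  have := Real.log_two_gt_d9
  linarith

def PP (σ : ℕ → ℤ) (s : Finset ℕ) (u c m : ℕ) : Prop :=
  m % u = c ∧ ∀ p ∈ s, jacobiSym (-(m : ℤ)) p = σ p

instance (σ : ℕ → ℤ) (s : Finset ℕ) (u c m : ℕ) : Decidable (PP σ s u c m) := by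
  unfold PP; infer_instance

lemma PP_prod (σ : ℕ → ℤ) (s : Finset ℕ) (u c j : ℕ) (hc : c < u) :
    ∏ p ∈ s, ff σ p (u * j + c) = if PP σ s u c (u * j + c) then 1 else 0 := by
  unfold ff PP
  rw [prod_ite_zero]
  have : (u * j + c) % u = c := by
    rw [Nat.mul_add_mod, Nat.mod_eq_of_lt hc]
  simp [this]

lemma cnt_eq (σ : ℕ → ℤ) (s : Finset ℕ) (u c z : ℕ) (hc : c < u) :
    ((((range (z + 1)).filter (PP σ s u c)).card : ℕ) : ℂ) =
      ∑ j ∈ range ((z + u - c) / u), ∏ p ∈ s, ff σ p (u * j + c) := by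
  simp_rw [PP_prod σ s u c _ hc]
  rw [← sum_filter]
  rw [sum_const, nsmul_eq_mul, mul_one]
  congr 1
  have hu : 0 < u := by omega
  symm
  apply card_bij (fun j _ => u * j + c)
  · intro j hj
    simp only [mem_filter, mem_range] at hj ⊢
    refine ⟨?_, hj.2⟩
    have h1 := hj.1
    have h2 : (j + 1) * u ≤ z + u - c := (Nat.le_div_iff_mul_le hu).mp h1
    have : (j + 1) * u = u * j + u := by ring
    omega
  · intro a _ b _ h
    have : u * a = u * b := by omega
    exact Nat.eq_of_mul_eq_mul_left hu this
  · intro m hm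
    simp only [mem_filter, mem_range] at hm
    have h1 : m % u = c := hm.2.1
    have h2 : u * (m / u) + c = m := by rw [← h1]; exact Nat.div_add_mod m u
    refine ⟨m / u, ?_, h2⟩
    simp only [mem_filter, mem_range]
    rw [h2]
    refine ⟨?_, hm.2⟩
    rw [← Nat.succ_le_iff, Nat.le_div_iff_mul_le hu, Nat.succ_mul, mul_comm]
    omega

noncomputable def rho (s : Finset ℕ) : ℝ := ∏ p ∈ s, (((p : ℝ) - 1) / 2 / p)

lemma rho_nonneg (s : Finset ℕ) (hs : ∀ p ∈ s, p.Prime ∧ p ≠ 2) : 0 ≤ rho s := by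
  apply prod_nonneg
  intro p hp
  have : (1 : ℝ) ≤ p := by exact_mod_cast (hs p hp).1.one_lt.le
  have : (0 : ℝ) ≤ p - 1 := by linarith
  positivity

lemma rho_le_one (s : Finset ℕ) (hs : ∀ p ∈ s, p.Prime ∧ p ≠ 2) : rho s ≤ 1 := by
  apply prod_le_one
  · intro p hp
    have : (1 : ℝ) ≤ p := by exact_mod_cast (hs p hp).1.one_lt.le
    have : (0 : ℝ) ≤ p - 1 := by linarith
    positivity
  · intro p hp
    have : (1 : ℝ) ≤ p := by exact_mod_cast (hs p hp).1.one_lt.le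
    rw [div_le_one (by linarith)]
    linarith

lemma cnt_bound (σ : ℕ → ℤ) (hσ : ∀ p, σ p = 1 ∨ σ p = -1) (s : Finset ℕ)
    (hs : ∀ p ∈ s, p.Prime ∧ p ≠ 2) (u c : ℕ) (hc : c < u) (hu : ∀ p ∈ s, Nat.Coprime u p)
    (N : ℕ) (hN : 2 ≤ N) (hQN : ∏ p ∈ s, p ≤ N) (z : ℕ) :
    |((((range (z + 1)).filter (PP σ s u c)).card : ℕ) : ℝ) - z * (rho s / u)|
      ≤ 6 * (Real.sqrt N * Real.log N) + 1 := by
  set Q := ∏ p ∈ s, p with hQdef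
  have hQ : 0 < Q := prod_pos_primes s (fun p hp => (hs p hp).1)
  have hdvd : ∀ p ∈ s, p ∣ Q := fun p hp => dvd_prod_of_mem _ hp
  set J := (z + u - c) / u with hJ
  have h1 := completion Q hQ (fun j => ∏ p ∈ s, ff σ p (u * j + c))
    (fun j => ff_periodic σ s u c _ _ Q hdvd (Nat.mod_modEq _ _)) (WW s)
    (fun h => ff_bound σ hσ c h s hs u hu)
    (by
      intro h h0 hh
      unfold WW
      apply prod_congr rfl
      intro p hp
      have : p ∣ Q - h ↔ p ∣ h := by
        rw [Nat.dvd_sub_iff_right hh.le (hdvd p hp)]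
      simp only [this]) J
  rw [← cnt_eq σ s u c z hc, ff_zero σ hσ c s hs u hu] at h1
  have h2 := WW_sum s (fun p hp => (hs p hp).1) Q
  have h3 := prod_sqrt_le s hs
  have h4 := harm_le Q N hQN hN
  have hlog : 0 ≤ Real.log N := Real.log_natCast_nonneg N
  have hE : ∑ h ∈ Ioo 0 Q, WW s h / h ≤ 6 * (Real.sqrt N * Real.log N) := by
    calc _ ≤ _ := h2
      _ ≤ (2 * Real.sqrt N) * (3 * Real.log N) := by
        apply mul_le_mul _ h4
        · apply sum_nonneg; intros; positivity
        · positivity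
        · refine h3.trans ?_
          gcongr
      _ = _ := by ring
  have hQ0 : (Q : ℂ) ≠ 0 := by exact_mod_cast hQ.ne'
  have hrho : (J : ℂ) / Q * ∏ p ∈ s, (((p : ℂ) - 1) / 2) = ((J * rho s : ℝ) : ℂ) := by
    have hQc : (Q : ℂ) = ∏ p ∈ s, (p : ℂ) := by rw [hQdef]; push_cast; rfl
    rw [hQc]
    unfold rho
    push_cast
    simp only [prod_div_distrib]
    ring
  rw [hrho, ← Complex.ofReal_natCast, ← Complex.ofReal_sub, Complex.norm_real, Real.norm_eq_abs] at h1
  have hu0 : (0 : ℝ) < u := by exact_mod_cast (by omega : 0 < u)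
  have hJz : |(J : ℝ) - z / u| ≤ 1 := by
    have ha : J * u ≤ z + u - c := Nat.div_mul_le_self _ _
    have hb : z + u - c < (J + 1) * u := by
      have := Nat.lt_div_mul_add (a := z + u - c) (b := u) (by omega)
      rw [← hJ] at this
      linarith
    have ha' : J * u ≤ z + u := by omega
    have hb' : z < (J + 1) * u := by omega
    have ha2 : (J : ℝ) * u ≤ z + u := by exact_mod_cast ha'
    have hb2 : (z : ℝ) < (J + 1) * u := by exact_mod_cast hb'
    rw [abs_le]
    constructor
    · have : (z : ℝ) / u ≤ J + 1 := by rw [div_le_iff₀ hu0]; exact hb2.le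
      linarith
    · have : (J : ℝ) - 1 ≤ z / u := by rw [le_div_iff₀ hu0]; linarith
      linarith
  have h5 : |(J : ℝ) * rho s - z * (rho s / u)| ≤ 1 := by
    have : (J : ℝ) * rho s - z * (rho s / u) = ((J : ℝ) - z / u) * rho s := by ring
    rw [this, abs_mul, abs_of_nonneg (rho_nonneg s hs)]
    have := rho_le_one s hs
    have := rho_nonneg s hs
    have := abs_nonneg ((J : ℝ) - z / u)
    nlinarith
  refine (abs_sub_le _ ((J : ℝ) * rho s) _).trans ?_
  linarith

lemma A_bound (σ : ℕ → ℤ) (hσ : ∀ p, σ p = 1 ∨ σ p = -1) (s : Finset ℕ)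
    (hs : ∀ p ∈ s, p.Prime ∧ p ≠ 2) (u c : ℕ) (hc : c < u) (hu : ∀ p ∈ s, Nat.Coprime u p)
    (N : ℕ) (hN : 2 ≤ N) (hQN : ∏ p ∈ s, p ≤ N) (y : ℝ) (hy : 0 ≤ y) :
    |((((Ioc ⌊y⌋₊ ⌊2 * y⌋₊).filter (PP σ s u c)).card : ℕ) : ℝ) - y * (rho s / u)|
      ≤ min (2 * y) (20 * (Real.sqrt N * Real.log N)) := by
  have hu0 : (1 : ℝ) ≤ u := by exact_mod_cast (by omega : 1 ≤ u)
  have hr0 : 0 ≤ rho s / u := div_nonneg (rho_nonneg s hs) (by linarith)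
  have hr1 : rho s / u ≤ 1 := by
    rw [div_le_one (by linarith)]; exact (rho_le_one s hs).trans hu0
  have hfl : ⌊y⌋₊ ≤ ⌊2 * y⌋₊ := Nat.floor_mono (by linarith)
  apply le_min
  · have h1 : ((((Ioc ⌊y⌋₊ ⌊2 * y⌋₊).filter (PP σ s u c)).card : ℕ) : ℝ) ≤ 2 * y := by
      calc ((((Ioc ⌊y⌋₊ ⌊2 * y⌋₊).filter (PP σ s u c)).card : ℕ) : ℝ) ≤ (⌊2 * y⌋₊ : ℝ) := by
            have h := card_filter_le (Ioc ⌊y⌋₊ ⌊2 * y⌋₊) (PP σ s u c)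
            rw [Nat.card_Ioc] at h
            exact_mod_cast h.trans (Nat.sub_le _ _)
        _ ≤ 2 * y := Nat.floor_le (by linarith)
    have h2 : 0 ≤ y * (rho s / u) := by positivity
    have h3 : y * (rho s / u) ≤ 2 * y := by nlinarith
    rw [abs_le]
    constructor
    · have : (0 : ℝ) ≤ ((((Ioc ⌊y⌋₊ ⌊2 * y⌋₊).filter (PP σ s u c)).card : ℕ) : ℝ) := by positivity
      linarith
    · linarith
  · have hsplit : ((range (⌊2 * y⌋₊ + 1)).filter (PP σ s u c)).card =
        ((range (⌊y⌋₊ + 1)).filter (PP σ s u c)).card +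
        ((Ioc ⌊y⌋₊ ⌊2 * y⌋₊).filter (PP σ s u c)).card := by
      rw [← card_union_of_disjoint, ← filter_union]
      · congr 2
        ext k; simp only [mem_union, mem_range, mem_Ioc]; omega
      · apply disjoint_filter_filter
        rw [disjoint_left]
        intro k hk hk'
        simp only [mem_range, mem_Ioc] at hk hk'
        omega
    have hsplit' : ((((Ioc ⌊y⌋₊ ⌊2 * y⌋₊).filter (PP σ s u c)).card : ℕ) : ℝ) =
        ((range (⌊2 * y⌋₊ + 1)).filter (PP σ s u c)).card -
        ((range (⌊y⌋₊ + 1)).filter (PP σ s u c)).card := by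
      rw [hsplit]; push_cast; ring
    have b1 := cnt_bound σ hσ s hs u c hc hu N hN hQN ⌊2 * y⌋₊
    have b2 := cnt_bound σ hσ s hs u c hc hu N hN hQN ⌊y⌋₊
    have f1 := Nat.floor_le (by linarith : 0 ≤ 2 * y)
    have f2 := Nat.floor_le hy
    have f3 := Nat.lt_floor_add_one (2 * y)
    have f4 := Nat.lt_floor_add_one y
    rw [hsplit']
    have hbig : 1 / 2 ≤ Real.sqrt N * Real.log N := by
      have h2 : Real.log 2 ≤ Real.log N := by
        apply Real.log_le_log (by norm_num); exact_mod_cast hN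
      have h3 := Real.log_two_gt_d9
      have h4 : (1 : ℝ) ≤ Real.sqrt N := by
        rw [Real.one_le_sqrt]; exact_mod_cast (by omega : 1 ≤ N)
      nlinarith
    set r := rho s / u
    rw [abs_le] at b1 b2 ⊢
    have g1 : (⌊2 * y⌋₊ : ℝ) * r ≤ 2 * y * r := by gcongr
    have g2 : (⌊y⌋₊ : ℝ) * r ≤ y * r := by gcongr
    have g3 : 2 * y * r - 1 ≤ (⌊2 * y⌋₊ : ℝ) * r := by nlinarith
    have g4 : y * r - 1 ≤ (⌊y⌋₊ : ℝ) * r := by nlinarith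
    constructor
    · linarith [b1.1, b2.2]
    · linarith [b1.2, b2.1]

lemma PP_sq (σ : ℕ → ℤ) (s : Finset ℕ) (hs : ∀ p ∈ s, p.Prime ∧ p ≠ 2) (u c : ℕ) (hu8 : u ∣ 8)
    (k m : ℕ) (hk : ∀ p ∈ insert 2 s, ¬ p ∣ k) : PP σ s u c (k ^ 2 * m) ↔ PP σ s u c m := by
  have h2 : k % 2 = 1 := by
    have := hk 2 (mem_insert_self _ _)
    omega
  have h8 : k ^ 2 ≡ 1 [MOD 8] := by
    have : k % 8 = 1 ∨ k % 8 = 3 ∨ k % 8 = 5 ∨ k % 8 = 7 := by omega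
    rcases this with h | h | h | h <;> simp [Nat.ModEq, Nat.pow_mod, h]
  have hu : k ^ 2 * m % u = m % u := by
    have := (h8.of_dvd hu8).mul_right m
    rwa [one_mul] at this
  unfold PP
  rw [hu]
  have : ∀ p ∈ s, jacobiSym (-((k ^ 2 * m : ℕ) : ℤ)) p = jacobiSym (-(m : ℤ)) p := by
    intro p hp
    have hcop : Int.gcd (k : ℤ) p = 1 := by
      rw [Int.gcd_natCast_natCast, Nat.gcd_comm]
      exact ((hs p hp).1.coprime_iff_not_dvd).mpr (hk p (mem_insert_of_mem hp))
    have e : (-((k ^ 2 * m : ℕ) : ℤ)) = (k : ℤ) ^ 2 * (-(m : ℤ)) := by push_cast; ring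
    rw [e, jacobiSym.mul_left, jacobiSym.sq_one' hcop, one_mul]
  constructor
  · rintro ⟨h1, h2⟩
    exact ⟨h1, fun p hp => by rw [← this p hp]; exact h2 p hp⟩
  · rintro ⟨h1, h2⟩
    exact ⟨h1, fun p hp => by rw [this p hp]; exact h2 p hp⟩

lemma PP_not (σ : ℕ → ℤ) (hσ : ∀ p, σ p = 1 ∨ σ p = -1) (s : Finset ℕ)
    (hs : ∀ p ∈ s, p.Prime ∧ p ≠ 2) (u c : ℕ) (hu2 : 2 ∣ u) (hc2 : c % 2 = 1)
    (d : ℕ) (h : PP σ s u c d) : ∀ p ∈ insert 2 s, ¬ p ∣ d := by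
  intro p hp hd
  rw [mem_insert] at hp
  rcases hp with rfl | hp
  · have h1 := h.1
    have : d % u % 2 = d % 2 := Nat.mod_mod_of_dvd _ hu2
    omega
  · have h1 := h.2 p hp
    have hpp := (hs p hp).1
    have : jacobiSym (-(d : ℤ)) p = 0 := by
      rw [jacobiSym.eq_zero_iff]
      refine ⟨hpp.ne_zero, ?_⟩
      rw [Int.neg_gcd, Int.gcd_natCast_natCast, Nat.gcd_eq_right hd]
      exact hpp.one_lt.ne'
    rw [this] at h1
    rcases hσ p with h2 | h2 <;> rw [h2] at h1 <;> norm_num at h1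

lemma S_eq (σ : ℕ → ℤ) (hσ : ∀ p, σ p = 1 ∨ σ p = -1) (s : Finset ℕ)
    (hs : ∀ p ∈ s, p.Prime ∧ p ≠ 2) (u c : ℕ) (hu8 : u ∣ 8) (hu2 : 2 ∣ u) (hc2 : c % 2 = 1)
    (x : ℝ) (hx : 0 ≤ x) (n : ℕ) (hn : ⌊2 * x⌋₊ < n) :
    ((((Ioc ⌊x⌋₊ ⌊2 * x⌋₊).filter (fun d => Squarefree d ∧ PP σ s u c d)).card : ℕ) : ℝ) =
      ∑ k ∈ Ioo 0 n, cmu (insert 2 s) k *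
        (((Ioc ⌊x / (k : ℝ) ^ 2⌋₊ ⌊2 * (x / (k : ℝ) ^ 2)⌋₊).filter (PP σ s u c)).card : ℕ) := by
  have h1 : ((((Ioc ⌊x⌋₊ ⌊2 * x⌋₊).filter (fun d => Squarefree d ∧ PP σ s u c d)).card : ℕ) : ℝ) =
      ∑ d ∈ (Ioc ⌊x⌋₊ ⌊2 * x⌋₊).filter (PP σ s u c), ∑ k ∈ Ioo 0 n,
        if k ^ 2 ∣ d then (ArithmeticFunction.moebius k : ℝ) else 0 := by
    have hfil : (Ioc ⌊x⌋₊ ⌊2 * x⌋₊).filter (fun d => Squarefree d ∧ PP σ s u c d) =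
        ((Ioc ⌊x⌋₊ ⌊2 * x⌋₊).filter (PP σ s u c)).filter Squarefree := by
      ext d; simp only [mem_filter]; tauto
    rw [hfil, card_eq_sum_ones, sum_filter]
    push_cast
    apply sum_congr rfl
    intro d hd
    simp only [mem_filter, mem_Ioc] at hd
    have := aux_sqfree_sum d n (by omega) (by omega)
    rw [← sum_filter]
    have h2 : (∑ k ∈ (Ioo 0 n).filter (fun k => k ^ 2 ∣ d), (ArithmeticFunction.moebius k : ℝ))
      = ((∑ k ∈ (Ioo 0 n).filter (fun k => k ^ 2 ∣ d), ArithmeticFunction.moebius k : ℤ) : ℝ) := by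
      push_cast; rfl
    rw [h2, this]
    split_ifs <;> simp
  rw [h1, sum_comm]
  apply sum_congr rfl
  intro k hk
  have hk0 : 0 < k := (mem_Ioo.mp hk).1
  have hk2 : (0 : ℝ) < (k : ℝ) ^ 2 := by positivity
  rw [← sum_filter, sum_const, nsmul_eq_mul, mul_comm]
  unfold cmu
  split_ifs with hL
  · congr 2
    symm
    apply card_bij (fun m _ => k ^ 2 * m)
    · intro m hm
      simp only [mem_filter, mem_Ioc] at hm ⊢
      obtain ⟨⟨ha, hb⟩, hP⟩ := hm
      refine ⟨⟨⟨?_, ?_⟩, (PP_sq σ s hs u c hu8 k m hL).mpr hP⟩, dvd_mul_right _ _⟩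
      · rw [Nat.floor_lt (by positivity)] at ha
        rw [Nat.floor_lt hx]
        rw [div_lt_iff₀ hk2] at ha
        push_cast; linarith
      · have hm0 : m ≠ 0 := by omega
        rw [Nat.le_floor_iff (by positivity)] at hb
        rw [Nat.le_floor_iff (by positivity)]
        rw [← mul_div_assoc, le_div_iff₀ hk2] at hb
        push_cast; linarith
    · intro a _ b _ h
      exact Nat.eq_of_mul_eq_mul_left (by positivity) h
    · intro d hd
      simp only [mem_filter, mem_Ioc] at hd
      obtain ⟨⟨⟨ha, hb⟩, hP⟩, m, rfl⟩ := hd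
      refine ⟨m, ?_, rfl⟩
      simp only [mem_filter, mem_Ioc]
      refine ⟨⟨?_, ?_⟩, (PP_sq σ s hs u c hu8 k m hL).mp hP⟩
      · rw [Nat.floor_lt (by positivity), div_lt_iff₀ hk2]
        rw [Nat.floor_lt hx] at ha
        push_cast at ha; linarith
      · rw [Nat.le_floor_iff (by positivity), ← mul_div_assoc, le_div_iff₀ hk2]
        rw [Nat.le_floor_iff (by positivity)] at hb
        push_cast at hb; linarith
  · rw [zero_mul]
    have : ((Ioc ⌊x⌋₊ ⌊2 * x⌋₊).filter (PP σ s u c)).filter (fun d => k ^ 2 ∣ d) = ∅ := by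
      rw [filter_eq_empty_iff]
      intro d hd hkd
      apply hL
      intro p hp hpk
      exact PP_not σ hσ s hs u c hu2 hc2 d (mem_filter.mp hd).2 p hp
        ((hpk.trans (dvd_pow_self k two_ne_zero)).trans hkd)
    rw [this]; simp

lemma generic_count (σ : ℕ → ℤ) (hσ : ∀ p, σ p = 1 ∨ σ p = -1) (s : Finset ℕ)
    (hs : ∀ p ∈ s, p.Prime ∧ p ≠ 2) (u c : ℕ) (hu8 : u ∣ 8) (hu2 : 2 ∣ u) (hc2 : c % 2 = 1)
    (hc : c < u) (N : ℕ) (hN : 2 ≤ N) (hQN : ∏ p ∈ s, p ≤ N) (x : ℝ) (hx : 1 < x) :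
    |((((Ioc ⌊x⌋₊ ⌊2 * x⌋₊).filter (fun d => Squarefree d ∧ PP σ s u c d)).card : ℕ) : ℝ) -
      x * (rho s / u) * ((Real.pi ^ 2 / 6)⁻¹ * ∏ p ∈ insert 2 s, (1 - ((p : ℝ) ^ 2)⁻¹)⁻¹)|
      ≤ 3 * Real.sqrt ((2 * x) * (20 * (Real.sqrt N * Real.log N))) := by
  have hu : ∀ p ∈ s, Nat.Coprime u p := by
    intro p hp
    have : Nat.Coprime 2 p := (Nat.coprime_primes Nat.prime_two (hs p hp).1).mpr (hs p hp).2.symm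
    exact Nat.Coprime.coprime_dvd_left hu8 (Nat.Coprime.pow_left 3 this)
  have hL : ∀ p ∈ insert 2 s, p.Prime := by
    intro p hp
    rcases mem_insert.mp hp with rfl | hp
    · exact Nat.prime_two
    · exact (hs p hp).1
  have hlog : 0 < Real.log N := Real.log_pos (by exact_mod_cast (by omega : 1 < N))
  have hNp : (0 : ℝ) < N := by exact_mod_cast (by omega : 0 < N)
  have hE : 0 < 20 * (Real.sqrt N * Real.log N) := by
    have := Real.sqrt_pos.mpr hNp
    positivity
  have hT := cmu_tendsto (insert 2 s) hL
  have hT2 := ((hT.const_mul (x * (rho s / u))).const_sub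
    ((((Ioc ⌊x⌋₊ ⌊2 * x⌋₊).filter (fun d => Squarefree d ∧ PP σ s u c d)).card : ℕ) : ℝ)).abs
  refine le_of_tendsto hT2 ?_
  filter_upwards [eventually_gt_atTop ⌊2 * x⌋₊] with n hn
  rw [S_eq σ hσ s hs u c hu8 hu2 hc2 x (by linarith) n hn, mul_sum, ← sum_sub_distrib]
  refine (abs_sum_le_sum_abs _ _).trans ?_
  refine le_trans (sum_le_sum ?_) (aux_sum_min (2 * x) _ (by linarith) hE n)
  intro k hk
  have hk0 : (0 : ℝ) < k := by exact_mod_cast (mem_Ioo.mp hk).1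
  have hA := A_bound σ hσ s hs u c hc hu N hN hQN (x / (k : ℝ) ^ 2) (by positivity)
  rw [mul_div_assoc]
  refine le_trans ?_ hA
  have : ∀ A : ℝ, cmu (insert 2 s) k * A - x * (rho s / u) * (cmu (insert 2 s) k / (k : ℝ) ^ 2)
      = cmu (insert 2 s) k * (A - x / (k : ℝ) ^ 2 * (rho s / u)) := by
    intro A; ring
  rw [this, abs_mul]
  exact mul_le_of_le_one_left (abs_nonneg _) (cmu_abs_le _ _)

lemma rho_main (s : Finset ℕ) (hs : ∀ p ∈ s, p.Prime ∧ p ≠ 2) (u w : ℕ) (hu0 : 0 < u)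
    (hw : 2 ^ (w + 1) * 2 = u * 2 ^ s.card) (x : ℝ) :
    x * (rho s / u) * ((Real.pi ^ 2 / 6)⁻¹ * ∏ p ∈ insert 2 s, (1 - ((p : ℝ) ^ 2)⁻¹)⁻¹) =
    x / (2 ^ (w + 1) * (Real.pi ^ 2 / 6) * ∏ p ∈ insert 2 s, (1 + 1 / (p : ℝ))) := by
  have h2 : 2 ∉ s := fun h => (hs 2 h).2 rfl
  have hw' : (2 : ℝ) ^ (w + 1) * 2 = u * 2 ^ s.card := by exact_mod_cast hw
  have h1 : rho s * ∏ p ∈ s, (1 - ((p : ℝ) ^ 2)⁻¹)⁻¹ =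
      ((2 : ℝ) ^ s.card)⁻¹ * (∏ p ∈ s, (1 + 1 / (p : ℝ)))⁻¹ := by
    rw [rho, ← prod_mul_distrib, ← prod_inv_distrib, ← inv_pow, ← prod_const, ← prod_mul_distrib]
    apply prod_congr rfl
    intro p hp
    have hp1 : (1 : ℝ) < p := by exact_mod_cast (hs p hp).1.one_lt
    have ha : (p : ℝ) - 1 ≠ 0 := by linarith
    have hb : (p : ℝ) + 1 ≠ 0 := by linarith
    have hc : (p : ℝ) ≠ 0 := by linarith
    have e1 : 1 - ((p : ℝ) ^ 2)⁻¹ = (p - 1) * (p + 1) / p ^ 2 := by field_simp; ring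
    have e2 : 1 + 1 / (p : ℝ) = (p + 1) / p := by field_simp
    rw [e1, e2]
    field_simp
  have hP : 0 < ∏ p ∈ s, (1 + 1 / (p : ℝ)) := prod_pos (fun p _ => by positivity)
  have hu : (0 : ℝ) < u := by exact_mod_cast hu0
  rw [prod_insert h2, prod_insert h2]
  have h3 : x * (rho s / u) * ((Real.pi ^ 2 / 6)⁻¹ * ((1 - (((2 : ℕ) : ℝ) ^ 2)⁻¹)⁻¹ *
      ∏ p ∈ s, (1 - ((p : ℝ) ^ 2)⁻¹)⁻¹)) = x * (Real.pi ^ 2 / 6)⁻¹ * (4 / 3) * (u : ℝ)⁻¹ *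
      (rho s * ∏ p ∈ s, (1 - ((p : ℝ) ^ 2)⁻¹)⁻¹) := by
    push_cast
    norm_num
    ring
  rw [h3, h1]
  have h4 : (2 : ℝ) ^ (w + 1) = u * 2 ^ s.card / 2 := by linarith
  rw [h4]
  have := Real.pi_pos
  push_cast
  field_simp
  norm_num
  ring

/-- **Counting imaginary quadratic fields with prescribed splitting (from the proof
of Theorem ThmCountingFields).**
There is an absolute constant `C > 0` such that for all coprime positive integers
`D, M` with `N := DM ≥ 2` and all real `x > 1`, the number of positive integers `d`
with `x < d ≤ 2x`, `d` squarefree, `d ≡ 3 (mod 4)`, every prime `p | M` split in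
`ℚ(√−d)` and every prime `p | D` inert in `ℚ(√−d)`, differs from
`x / (2^(ω(N)+1) · ζ(2) · ∏_{p | 2N} (1 + 1/p))` by at most
`C · x^(1/2) · N^(1/4) · (log N)^(1/2)`. -/
theorem counting_imaginary_quadratic_with_splitting :
    ∃ C : ℝ, 0 < C ∧ ∀ (D M : ℕ) (x : ℝ), 0 < D → 0 < M → Nat.Coprime D M →
      2 ≤ D * M → 1 < x →
      |({d : ℕ | x < (d : ℝ) ∧ (d : ℝ) ≤ 2 * x ∧ Squarefree d ∧ d % 4 = 3 ∧
            (∀ p ∈ M.primeFactors,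
              if p = 2 then d % 8 = 7 else jacobiSym (-(d : ℤ)) p = 1) ∧
            (∀ p ∈ D.primeFactors,
              if p = 2 then d % 8 = 3 else jacobiSym (-(d : ℤ)) p = -1)}.ncard : ℝ)
          - x / (2 ^ ((D * M).primeFactors.card + 1) * (Real.pi ^ 2 / 6) *
              ∏ p ∈ (2 * (D * M)).primeFactors, (1 + 1 / (p : ℝ)))|
        ≤ C * x ^ ((1 : ℝ) / 2) * ((D * M : ℕ) : ℝ) ^ ((1 : ℝ) / 4) *
            (Real.log (D * M)) ^ ((1 : ℝ) / 2) := by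
  
  refine ⟨3 * Real.sqrt 40, by positivity, ?_⟩
  intro D M x hD hM hcop hN hx
  set N := D * M with hNdef
  have hN0 : N ≠ 0 := by omega
  set σ : ℕ → ℤ := fun p => if p ∣ M then 1 else -1 with hσdef
  have hσ : ∀ p, σ p = 1 ∨ σ p = -1 := by
    intro p; simp only [hσdef]; split_ifs <;> simp
  set s := N.primeFactors.erase 2 with hsdef
  have hs : ∀ p ∈ s, p.Prime ∧ p ≠ 2 := by
    intro p hp
    rw [hsdef, mem_erase] at hp
    exact ⟨Nat.prime_of_mem_primeFactors hp.2, hp.1⟩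
  set u : ℕ := if 2 ∣ N then 8 else 4 with hu
  set c : ℕ := if 2 ∣ M then 7 else 3 with hc
  have h2N : 2 ∣ N ↔ 2 ∣ D ∨ 2 ∣ M := Nat.prime_two.dvd_mul
  have h2DM : ¬ (2 ∣ D ∧ 2 ∣ M) := fun h => Nat.not_coprime_of_dvd_of_dvd one_lt_two h.1 h.2 hcop
  have hu8 : u ∣ 8 := by rw [hu]; split_ifs <;> norm_num
  have hu2 : 2 ∣ u := by rw [hu]; split_ifs <;> norm_num
  have hu0 : 0 < u := by rw [hu]; split_ifs <;> norm_num
  have hc2 : c % 2 = 1 := by rw [hc]; split_ifs <;> norm_num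
  have hcu : c < u := by
    rw [hc, hu]
    by_cases hm : 2 ∣ M
    · rw [if_pos hm, if_pos (h2N.mpr (Or.inr hm))]; norm_num
    · rw [if_neg hm]; split_ifs <;> norm_num
  have hQN : ∏ p ∈ s, p ≤ N := by
    refine le_trans ?_ (Nat.le_of_dvd (by omega) (Nat.prod_primeFactors_dvd N))
    apply Finset.prod_le_prod_of_subset_of_one_le' (erase_subset _ _)
    intro p hp _
    exact (Nat.prime_of_mem_primeFactors hp).one_lt.le
  have hpf : (2 * N).primeFactors = insert 2 s := by
    rw [Nat.primeFactors_mul two_ne_zero hN0, Nat.Prime.primeFactors Nat.prime_two, hsdef]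
    ext p; simp only [mem_union, mem_singleton, mem_insert, mem_erase]; tauto
  have hw : 2 ^ (N.primeFactors.card + 1) * 2 = u * 2 ^ s.card := by
    by_cases h : 2 ∣ N
    · have hmem : 2 ∈ N.primeFactors := Nat.mem_primeFactors.mpr ⟨Nat.prime_two, h, hN0⟩
      have : N.primeFactors.card = s.card + 1 := (card_erase_add_one hmem).symm
      rw [this, hu, if_pos h]; ring
    · have hmem : 2 ∉ N.primeFactors := fun hm => h (Nat.dvd_of_mem_primeFactors hm)
      have : N.primeFactors = s := (erase_eq_of_notMem hmem).symm
      rw [this, hu, if_neg h]; ring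
  have hcond : ∀ d : ℕ, (d % 4 = 3 ∧
            (∀ p ∈ M.primeFactors,
              if p = 2 then d % 8 = 7 else jacobiSym (-(d : ℤ)) p = 1) ∧
            (∀ p ∈ D.primeFactors,
              if p = 2 then d % 8 = 3 else jacobiSym (-(d : ℤ)) p = -1)) ↔ PP σ s u c d := by
    intro d
    have hmemM : ∀ p, p ∈ M.primeFactors ↔ p.Prime ∧ p ∣ M := by
      intro p; rw [Nat.mem_primeFactors]; simp [hM.ne']
    have hmemD : ∀ p, p ∈ D.primeFactors ↔ p.Prime ∧ p ∣ D := by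
      intro p; rw [Nat.mem_primeFactors]; simp [hD.ne']
    constructor
    · rintro ⟨h4, hMc, hDc⟩
      refine ⟨?_, ?_⟩
      · by_cases hm : 2 ∣ M
        · have := hMc 2 ((hmemM 2).mpr ⟨Nat.prime_two, hm⟩)
          rw [if_pos rfl] at this
          rw [hu, hc, if_pos (h2N.mpr (Or.inr hm)), if_pos hm]; exact this
        · by_cases hd : 2 ∣ D
          · have := hDc 2 ((hmemD 2).mpr ⟨Nat.prime_two, hd⟩)
            rw [if_pos rfl] at this
            rw [hu, hc, if_pos (h2N.mpr (Or.inl hd)), if_neg hm]; exact this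
          · rw [hu, hc, if_neg (fun h => (h2N.mp h).elim hd hm), if_neg hm]; exact h4
      · intro p hp
        have hp2 := (hs p hp).2
        have hpp := (hs p hp).1
        have hpN : p ∣ N := Nat.dvd_of_mem_primeFactors (mem_of_mem_erase hp)
        by_cases hm : p ∣ M
        · have := hMc p ((hmemM p).mpr ⟨hpp, hm⟩)
          rw [if_neg hp2] at this
          rw [this]; simp only [hσdef]; rw [if_pos hm]
        · have hd : p ∣ D := (hpp.dvd_mul.mp hpN).resolve_right hm
          have := hDc p ((hmemD p).mpr ⟨hpp, hd⟩)
          rw [if_neg hp2] at this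
          rw [this]; simp only [hσdef]; rw [if_neg hm]
    · rintro ⟨h1, h2⟩
      have hin : ∀ p, p.Prime → p ∣ N → p ≠ 2 → p ∈ s := fun p hp hd h =>
        mem_erase.mpr ⟨h, Nat.mem_primeFactors.mpr ⟨hp, hd, hN0⟩⟩
      refine ⟨?_, ?_, ?_⟩
      · rw [hu, hc] at h1
        split_ifs at h1 <;> omega
      · intro p hp
        obtain ⟨hpp, hd⟩ := (hmemM p).mp hp
        split_ifs with h
        · subst h
          rw [hu, hc, if_pos (h2N.mpr (Or.inr hd)), if_pos hd] at h1
          exact h1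
        · have := h2 p (hin p hpp (hd.mul_left _) h)
          rw [this]; simp only [hσdef]; rw [if_pos hd]
      · intro p hp
        obtain ⟨hpp, hd⟩ := (hmemD p).mp hp
        have hm : ¬ p ∣ M := fun hm => Nat.not_coprime_of_dvd_of_dvd hpp.one_lt hd hm hcop
        split_ifs with h
        · subst h
          rw [hu, hc, if_pos (h2N.mpr (Or.inl hd)), if_neg hm] at h1
          exact h1
        · have := h2 p (hin p hpp (hd.mul_right _) h)
          rw [this]; simp only [hσdef]; rw [if_neg hm]
  have hset : {d : ℕ | x < (d : ℝ) ∧ (d : ℝ) ≤ 2 * x ∧ Squarefree d ∧ d % 4 = 3 ∧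
            (∀ p ∈ M.primeFactors,
              if p = 2 then d % 8 = 7 else jacobiSym (-(d : ℤ)) p = 1) ∧
            (∀ p ∈ D.primeFactors,
              if p = 2 then d % 8 = 3 else jacobiSym (-(d : ℤ)) p = -1)} =
      ↑((Ioc ⌊x⌋₊ ⌊2 * x⌋₊).filter (fun d => Squarefree d ∧ PP σ s u c d)) := by
    ext d
    simp only [Set.mem_ofPred_eq, coe_filter, mem_Ioc]
    rw [Nat.floor_lt (by linarith), Nat.le_floor_iff (by linarith), hcond d]
    tauto
  rw [hset, Set.ncard_coe_finset, hpf, ← rho_main s hs u _ hu0 hw x]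
  refine (generic_count σ hσ s hs u c hu8 hu2 hc2 hcu N hN hQN x hx).trans (le_of_eq ?_)
  have hlogN : Real.log (D * M) = Real.log N := by rw [hNdef]; push_cast; rfl
  have hlog : 0 ≤ Real.log N := Real.log_natCast_nonneg N
  rw [hlogN, ← Real.sqrt_eq_rpow, ← Real.sqrt_eq_rpow]
  have h4 : ((N : ℕ) : ℝ) ^ ((1 : ℝ) / 4) = Real.sqrt (Real.sqrt N) := by
    rw [Real.sqrt_eq_rpow, Real.sqrt_eq_rpow, ← Real.rpow_mul (by positivity)]
    norm_num
  rw [h4]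
  have h5 : (2 * x) * (20 * (Real.sqrt N * Real.log N)) = 40 * x * Real.sqrt N * Real.log N := by
    ring
  rw [h5, Real.sqrt_mul (by positivity), Real.sqrt_mul (by positivity), Real.sqrt_mul (by positivity)]
  ring
end

section
/- Let m > 1 be a positive integer and let χ be a non-principal Dirichlet character modulo m (not necessarily primitive), with complex values. Then for every real x ≥ 1, | ∑_{d ≤ x} μ²(d) χ(d) | ≤ 5 · x^{1/2} · m^{1/4} · (log m)^{1/2}, where the sum is over positive integers d ≤ x and μ is the Möbius function (so μ²(d) is the indicator of d being squarefree). -/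
open ZMod in
lemma norm_gauss_aux {q : ℕ} [NeZero q] (χ : DirichletCharacter ℂ q) (hχ : χ.IsPrimitive) :
    ‖gaussSum χ (stdAddChar (N := q))‖ = √(q : ℝ) := by
  have h := congrFun (ZMod.dft_dft (χ : ZMod q → ℂ)) (-1)
  have h2 : (𝓕 (χ : ZMod q → ℂ)) = fun k => χ⁻¹ (-k) * gaussSum χ stdAddChar := by
    ext k; exact hχ.fourierTransform_eq_inv_mul_gaussSum k
  rw [h2, dft_apply] at h
  simp only [neg_neg, map_one, smul_eq_mul, mul_one, mul_neg] at h
  have h3 : star (gaussSum χ (stdAddChar (N := q))) = ∑ k : ZMod q, stdAddChar k * χ⁻¹ (-k) := by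
    rw [star_gaussSum_eq, gaussSum, ← Equiv.sum_comp (Equiv.neg (ZMod q))]
    refine Finset.sum_congr rfl fun k _ => ?_
    simp [mul_comm]
  have h4 : star (gaussSum χ (stdAddChar (N := q))) * gaussSum χ (stdAddChar (N := q)) = q := by
    rw [h3, Finset.sum_mul, ← h]
    refine Finset.sum_congr rfl fun k _ => by ring
  have h5 : ‖gaussSum χ (stdAddChar (N := q))‖ * ‖gaussSum χ (stdAddChar (N := q))‖ = q := by
    have := congrArg norm h4
    rwa [norm_mul, norm_star, Complex.norm_natCast] at this
  rw [← h5, Real.sqrt_mul_self (norm_nonneg _)]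

lemma sin_lower_aux {t : ℝ} (h0 : 0 < t) (h1 : t < 1) :
    1 / Real.sin (Real.pi * t) ≤ (1 / t + 1 / (1 - t)) / 2 := by
  have hpi := Real.pi_pos
  have h1' : 0 < 1 - t := by linarith
  have key : ∀ s : ℝ, 0 < s → s ≤ 1/2 → 1 / Real.sin (Real.pi * s) ≤ (1 / s) / 2 := by
    intro s hs hs'
    have := Real.mul_le_sin (x := Real.pi * s) (by positivity) (by nlinarith)
    have e : 2 / Real.pi * (Real.pi * s) = 2 * s := by field_simp
    rw [e] at this
    rw [div_div, mul_comm s 2]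
    exact one_div_le_one_div_of_le (by positivity) this
  rcases le_total t (1/2) with h | h
  · have := key t h0 h
    have : 0 < 1 / (1 - t) := by positivity
    linarith
  · have := key (1 - t) h1' (by linarith)
    rw [mul_sub, mul_one, Real.sin_pi_sub] at this
    have : 0 < 1 / t := by positivity
    linarith

open ZMod in
lemma geom_aux {q : ℕ} [NeZero q] (a : ZMod q) (ha : a ≠ 0) (M : ℕ) :
    ‖∑ n ∈ Finset.Icc 1 M, stdAddChar (a * (n : ZMod q))‖ ≤
      q / 2 * ((a.val : ℝ)⁻¹ + ((q - a.val : ℕ) : ℝ)⁻¹) := by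
  have hq : (0 : ℝ) < q := by exact_mod_cast Nat.pos_of_ne_zero (NeZero.ne q)
  have hv : a.val < q := ZMod.val_lt a
  have hv0 : 0 < a.val := Nat.pos_of_ne_zero (by rwa [Ne, ZMod.val_eq_zero])
  have hvr : (a.val : ℝ) < q := by exact_mod_cast hv
  have hv0r : (0 : ℝ) < a.val := by exact_mod_cast hv0
  set z : ℂ := stdAddChar a with hz
  have hzn : ‖z‖ = 1 := by rw [hz]; exact AddChar.norm_apply _ _
  have hpow : ∀ n : ℕ, stdAddChar (a * (n : ZMod q)) = z ^ n := by
    intro n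
    rw [hz, ← AddChar.map_nsmul_eq_pow, nsmul_eq_mul, mul_comm]
  have hze : z - 1 = Complex.exp (Complex.I * ((2 * Real.pi * (a.val / q) : ℝ))) - 1 := by
    have := stdAddChar_coe (N := q) (a.val : ℤ)
    rw [hz]
    congr 1
    rw [Int.cast_natCast, ZMod.natCast_zmod_val] at this
    rw [this]; congr 1; push_cast; ring
  have t0 : 0 < (a.val / q : ℝ) := by positivity
  have t1 : (a.val / q : ℝ) < 1 := by rw [div_lt_one hq]; exact hvr
  have hsin : 0 < Real.sin (Real.pi * (a.val / q)) :=
    Real.sin_pos_of_pos_of_lt_pi (by have := Real.pi_pos; positivity)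
      (by have := Real.pi_pos; nlinarith)
  have hnorm : ‖z - 1‖ = 2 * Real.sin (Real.pi * (a.val / q)) := by
    rw [hze, Complex.norm_exp_I_mul_ofReal_sub_one]
    rw [show 2 * Real.pi * (a.val / q : ℝ) / 2 = Real.pi * (a.val / q) by ring, Real.norm_of_nonneg]
    positivity
  have hgeo : (∑ n ∈ Finset.Icc 1 M, stdAddChar (a * (n : ZMod q))) * (z - 1) = z ^ (M+1) - z := by
    simp_rw [hpow]
    rw [← Finset.Ico_add_one_right_eq_Icc, geom_sum_Ico_mul z (by omega), pow_one]
  have hle : ‖∑ n ∈ Finset.Icc 1 M, stdAddChar (a * (n : ZMod q))‖ * ‖z - 1‖ ≤ 2 := by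
    rw [← norm_mul, hgeo]
    refine (norm_sub_le _ _).trans ?_
    rw [norm_pow, hzn]; norm_num
  rw [hnorm] at hle
  have h6 : ‖∑ n ∈ Finset.Icc 1 M, stdAddChar (a * (n : ZMod q))‖ ≤
      1 / Real.sin (Real.pi * (a.val / q)) := by
    rw [le_div_iff₀ hsin]; linarith
  refine h6.trans ((sin_lower_aux t0 t1).trans (le_of_eq ?_))
  rw [Nat.cast_sub hv.le]
  have : (q : ℝ) - a.val ≠ 0 := by linarith
  have e : 1 - (a.val / q : ℝ) = (q - a.val) / q := by field_simp
  rw [e]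
  field_simp

lemma sum_val_aux {q : ℕ} [NeZero q] (f : ℕ → ℝ) :
    ∑ a ∈ (Finset.univ : Finset (ZMod q)).erase 0, f a.val = ∑ k ∈ Finset.Ico 1 q, f k := by
  refine Finset.sum_nbij' (fun a => a.val) (fun k => (k : ZMod q)) ?_ ?_ ?_ ?_ ?_
  · intro a ha
    have : a ≠ 0 := by simpa using ha
    simp only [Finset.mem_Ico]
    refine ⟨Nat.pos_of_ne_zero (by rwa [Ne, ZMod.val_eq_zero]), ZMod.val_lt a⟩
  · intro k hk
    simp only [Finset.mem_Ico] at hk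
    simp only [Finset.mem_erase, Finset.mem_univ, and_true]
    rw [Ne, ZMod.natCast_eq_zero_iff]
    exact Nat.not_dvd_of_pos_of_lt hk.1 hk.2
  · intro a _; simp
  · intro k hk
    simp only [Finset.mem_Ico] at hk
    exact ZMod.val_cast_of_lt hk.2
  · intros; rfl

open ZMod in
lemma pv_prim {q : ℕ} (hq : 1 < q) (χ : DirichletCharacter ℂ q) (hχ : χ.IsPrimitive) (M : ℕ) :
    ‖∑ n ∈ Finset.Icc 1 M, χ (n : ZMod q)‖ ≤ 3 * √(q : ℝ) * Real.log q := by
  have : NeZero q := ⟨by omega⟩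
  have hq0 : (0 : ℝ) < q := by exact_mod_cast (by omega : 0 < q)
  have hF : ∀ k, (𝓕 (χ : ZMod q → ℂ)) k = χ⁻¹ (-k) * gaussSum χ stdAddChar :=
    fun k => hχ.fourierTransform_eq_inv_mul_gaussSum k
  have hF0 : (𝓕 (χ : ZMod q → ℂ)) 0 = 0 := by
    rw [hF, neg_zero, DirichletCharacter.map_zero' _ (by omega), zero_mul]
  have hFn : ∀ k, ‖(𝓕 (χ : ZMod q → ℂ)) k‖ ≤ √(q : ℝ) := by
    intro k
    rw [hF, norm_mul, norm_gauss_aux χ hχ]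
    have := DirichletCharacter.norm_le_one χ⁻¹ (-k)
    nlinarith [Real.sqrt_nonneg (q : ℝ)]
  have hinv : ∀ n : ℕ, χ (n : ZMod q) =
      (q : ℂ)⁻¹ * ∑ a : ZMod q, stdAddChar (a * (n : ZMod q)) * (𝓕 (χ : ZMod q → ℂ)) a := by
    intro n
    have := congrFun (LinearEquiv.symm_apply_apply (ZMod.dft (N := q) (E := ℂ)) (χ : ZMod q → ℂ)) (n : ZMod q)
    rw [invDFT_apply] at this
    simpa [smul_eq_mul] using this.symm
  have hS : ∑ n ∈ Finset.Icc 1 M, χ (n : ZMod q) =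
      (q : ℂ)⁻¹ * ∑ a ∈ (Finset.univ : Finset (ZMod q)).erase 0,
        (∑ n ∈ Finset.Icc 1 M, stdAddChar (a * (n : ZMod q))) * (𝓕 (χ : ZMod q → ℂ)) a := by
    rw [Finset.sum_erase _ (by rw [hF0, mul_zero])]
    simp_rw [Finset.sum_mul]
    rw [Finset.sum_comm, Finset.mul_sum]
    exact Finset.sum_congr rfl fun n _ => hinv n
  have hharm : ∑ k ∈ Finset.Ico 1 q, (k : ℝ)⁻¹ ≤ 1 + Real.log q := by
    have h := harmonic_le_one_add_log (q - 1)
    rw [harmonic_eq_sum_Icc] at h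
    push_cast at h
    rw [show Finset.Ico 1 q = Finset.Icc 1 (q-1) by ext; simp; omega]
    refine h.trans ?_
    have : Real.log ((q - 1 : ℕ) : ℝ) ≤ Real.log q := by
      apply Real.log_le_log
      · exact_mod_cast (by omega : 0 < q - 1)
      · exact_mod_cast (by omega : q - 1 ≤ q)
    linarith
  have hrefl : ∑ k ∈ Finset.Ico 1 q, (((q - k : ℕ) : ℝ))⁻¹ = ∑ k ∈ Finset.Ico 1 q, (k : ℝ)⁻¹ := by
    refine Finset.sum_nbij' (fun k => q - k) (fun k => q - k) ?_ ?_ ?_ ?_ ?_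
    · intro k hk; simp only [Finset.mem_Ico] at *; omega
    · intro k hk; simp only [Finset.mem_Ico] at *; omega
    · intro k hk; simp only [Finset.mem_Ico] at *; omega
    · intro k hk; simp only [Finset.mem_Ico] at *; omega
    · intros; rfl
  have hlog : (1:ℝ)/2 ≤ Real.log q := by
    have h2 : Real.log 2 ≤ Real.log q := Real.log_le_log (by norm_num) (by exact_mod_cast hq)
    have := Real.log_two_gt_d9
    linarith
  rw [hS, norm_mul, norm_inv, Complex.norm_natCast]
  have hb : ‖∑ a ∈ (Finset.univ : Finset (ZMod q)).erase 0,
        (∑ n ∈ Finset.Icc 1 M, stdAddChar (a * (n : ZMod q))) * (𝓕 (χ : ZMod q → ℂ)) a‖ ≤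
      q * (1 + Real.log q) * √(q : ℝ) := by
    calc _ ≤ ∑ a ∈ (Finset.univ : Finset (ZMod q)).erase 0,
          (q / 2 * ((a.val : ℝ)⁻¹ + ((q - a.val : ℕ) : ℝ)⁻¹)) * √(q : ℝ) := by
            refine norm_sum_le_of_le _ fun a ha => ?_
            rw [norm_mul]
            have h1 := geom_aux a (by simpa using ha) M
            exact mul_le_mul h1 (hFn a) (norm_nonneg _) ((norm_nonneg _).trans h1)
      _ = (q / 2 * (∑ k ∈ Finset.Ico 1 q, (k : ℝ)⁻¹ + ∑ k ∈ Finset.Ico 1 q, (((q - k : ℕ) : ℝ))⁻¹)) * √(q : ℝ) := by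
            rw [← Finset.sum_mul, ← Finset.mul_sum,
              sum_val_aux (fun k => (k : ℝ)⁻¹ + ((q - k : ℕ) : ℝ)⁻¹), Finset.sum_add_distrib]
      _ ≤ _ := by
            rw [hrefl]
            have := Real.sqrt_nonneg (q : ℝ)
            refine mul_le_mul_of_nonneg_right ?_ this
            nlinarith
  calc _ ≤ (q : ℝ)⁻¹ * (q * (1 + Real.log q) * √(q : ℝ)) := by gcongr
    _ = (1 + Real.log q) * √(q : ℝ) := by field_simp
    _ ≤ _ := by nlinarith [Real.sqrt_nonneg (q : ℝ)]

open ArithmeticFunction in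
lemma sum_moebius_div (n : ℕ) :
    ∑ d ∈ n.divisors, (moebius d : ℤ) = if n = 1 then 1 else 0 := by
  rw [← coe_mul_zeta_apply, moebius_mul_coe_zeta, one_apply]

lemma sum_multiples_aux (N e : ℕ) (he : 0 < e) (g : ℕ → ℂ) :
    ∑ d ∈ Finset.Icc 1 N, (if e ∣ d then g d else 0) = ∑ n ∈ Finset.Icc 1 (N / e), g (e * n) := by
  rw [← Finset.sum_filter]
  symm
  refine Finset.sum_nbij' (fun n => e * n) (fun d => d / e) ?_ ?_ ?_ ?_ ?_
  · intro n hn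
    simp only [Finset.mem_Icc, Finset.mem_filter] at *
    refine ⟨⟨Nat.mul_pos he hn.1, ?_⟩, dvd_mul_right _ _⟩
    rw [mul_comm]; exact (Nat.le_div_iff_mul_le he).1 hn.2
  · intro d hd
    simp only [Finset.mem_Icc, Finset.mem_filter] at *
    exact ⟨Nat.div_pos (Nat.le_of_dvd hd.1.1 hd.2) he, Nat.div_le_div_right hd.1.2⟩
  · intro n _; exact Nat.mul_div_cancel_left n he
  · intro d hd
    simp only [Finset.mem_filter] at hd
    exact Nat.mul_div_cancel' hd.2
  · intros; rfl

lemma card_divisors_sqrt (r : ℕ) : (r.divisors.card : ℝ) ≤ 2 * √(r : ℝ) := by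
  have h1 : r.divisors ⊆ Finset.Icc 1 (Nat.sqrt r) ∪ (Finset.Icc 1 (Nat.sqrt r)).image (fun k => r / k) := by
    intro d hd
    have hr := (Nat.mem_divisors.1 hd).2
    obtain ⟨e, rfl⟩ := (Nat.mem_divisors.1 hd).1
    have hd0 : 0 < d := Nat.pos_of_ne_zero fun h => hr (by simp [h])
    have he0 : 0 < e := Nat.pos_of_ne_zero fun h => hr (by simp [h])
    simp only [Finset.mem_union, Finset.mem_Icc, Finset.mem_image, Nat.le_sqrt]
    rcases le_total d e with h | h
    · left; exact ⟨hd0, Nat.mul_le_mul_left d h⟩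
    · right; exact ⟨e, ⟨he0, Nat.mul_le_mul_right e h⟩, Nat.mul_div_cancel _ he0⟩
  have h2 : r.divisors.card ≤ 2 * Nat.sqrt r := by
    refine (Finset.card_le_card h1).trans ((Finset.card_union_le _ _).trans ?_)
    have := Finset.card_image_le (s := Finset.Icc 1 (Nat.sqrt r)) (f := fun k => r / k)
    simp at *; omega
  calc (r.divisors.card : ℝ) ≤ ((2 * Nat.sqrt r : ℕ) : ℝ) := by exact_mod_cast h2
    _ = 2 * (Nat.sqrt r : ℝ) := by push_cast; ring
    _ ≤ _ := by gcongr; exact Real.nat_sqrt_le_real_sqrt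

lemma norm_moebius_le (k : ℕ) : ‖((ArithmeticFunction.moebius k : ℤ) : ℂ)‖ ≤ 1 := by
  rw [Complex.norm_intCast]
  exact_mod_cast ArithmeticFunction.abs_moebius_le_one

lemma pv_general {m : ℕ} (hm : 1 < m) (χ : DirichletCharacter ℂ m) (hχ : χ ≠ 1) (M : ℕ) :
    ‖∑ n ∈ Finset.Icc 1 M, χ (n : ZMod m)‖ ≤ 6 * √(m : ℝ) * Real.log m := by
  have : NeZero m := ⟨by omega⟩
  obtain ⟨r, hr⟩ := χ.conductor_dvd_level
  have hq1 : χ.conductor ≠ 1 := fun h => hχ ((χ.eq_one_iff_conductor_eq_one).2 h)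
  have hq0 : χ.conductor ≠ 0 := χ.conductor_ne_zero
  have hq : 1 < χ.conductor := by omega
  have hprim := χ.primitiveCharacter_isPrimitive
  have happ : ∀ n : ℕ, n.Coprime m → χ (n : ZMod m) = χ.primitiveCharacter (n : ZMod χ.conductor) := by
    intro n hn
    have := χ.primitiveCharacter_apply_of_isCoprime (a := (n : ℤ)) (Nat.isCoprime_iff_coprime.2 hn)
    simpa using this.symm
  generalize χ.primitiveCharacter = ψ at hprim happ
  generalize χ.conductor = q at *
  have hr0 : r ≠ 0 := by rintro rfl; simp at hr; omega
  have hchi : ∀ n ∈ Finset.Icc 1 M, χ (n : ZMod m) =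
      ∑ d ∈ r.divisors, (if d ∣ n then ((ArithmeticFunction.moebius d : ℤ) : ℂ) * ψ (n : ZMod q) else 0) := by
    intro n hn
    have hn0 : n ≠ 0 := by simp at hn; omega
    have h1 : ∑ d ∈ r.divisors, (if d ∣ n then ((ArithmeticFunction.moebius d : ℤ) : ℂ) * ψ (n : ZMod q) else 0)
        = (if Nat.gcd r n = 1 then 1 else 0) * ψ (n : ZMod q) := by
      rw [← Finset.sum_filter, ← Finset.sum_mul]
      have h3 : r.divisors.filter (fun d => d ∣ n) = (Nat.gcd r n).divisors := by
        ext d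
        simp [Nat.dvd_gcd_iff, hr0]
      have := sum_moebius_div (Nat.gcd r n)
      rw [h3]
      congr 1
      exact_mod_cast congrArg (Int.cast : ℤ → ℂ) this
    rw [h1]
    by_cases hnq : n.Coprime q
    · split_ifs with h
      · rw [one_mul, happ]
        rw [hr]; exact Nat.Coprime.mul_right hnq (Nat.Coprime.symm h)
      · rw [zero_mul]
        apply MulChar.map_nonunit
        rw [ZMod.isUnit_iff_coprime, hr]
        intro h'; exact h (Nat.Coprime.symm (Nat.Coprime.coprime_mul_left_right h'))
    · rw [MulChar.map_nonunit ψ (by rwa [ZMod.isUnit_iff_coprime]), mul_zero]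
      apply MulChar.map_nonunit
      rw [ZMod.isUnit_iff_coprime, hr]
      intro h'; exact hnq (Nat.Coprime.coprime_mul_right_right h')
  rw [Finset.sum_congr rfl hchi, Finset.sum_comm]
  have hlog : 0 ≤ Real.log q := Real.log_natCast_nonneg q
  calc _ ≤ ∑ d ∈ r.divisors, 3 * √(q : ℝ) * Real.log q := by
        refine norm_sum_le_of_le _ fun d hd => ?_
        rw [sum_multiples_aux M d (Nat.pos_of_mem_divisors hd)
          (fun n => ((ArithmeticFunction.moebius d : ℤ) : ℂ) * ψ (n : ZMod q))]
        simp_rw [Nat.cast_mul, map_mul, ← mul_assoc]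
        rw [← Finset.mul_sum, norm_mul, norm_mul]
        have a1 := norm_moebius_le d
        have a2 := DirichletCharacter.norm_le_one ψ (d : ZMod q)
        have a3 := pv_prim hq ψ hprim (M / d)
        have a4 := mul_le_one₀ a1 (norm_nonneg _) a2
        exact (mul_le_of_le_one_left (norm_nonneg _) a4).trans a3
    _ = r.divisors.card * (3 * √(q : ℝ) * Real.log q) := by simp
    _ ≤ (2 * √(r : ℝ)) * (3 * √(q : ℝ) * Real.log m) := by
        have : Real.log q ≤ Real.log m := by
          apply Real.log_le_log (by exact_mod_cast (by omega : 0 < q))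
          exact_mod_cast Nat.le_of_dvd (by omega) ⟨r, hr⟩
        have := card_divisors_sqrt r
        gcongr
    _ = _ := by
        rw [hr, Nat.cast_mul, Real.sqrt_mul (by positivity)]; ring

lemma moebius_sq_sum (d N : ℕ) (hd : 0 < d) (hN : d ≤ N) :
    ((ArithmeticFunction.moebius d : ℤ)) ^ 2 =
      ∑ k ∈ Finset.Icc 1 N, if k ^ 2 ∣ d then ArithmeticFunction.moebius k else 0 := by
  obtain ⟨a, b, ha, hb, hab, hsq⟩ := Nat.sq_mul_squarefree_of_pos hd
  have key : ∀ k, k ^ 2 ∣ d ↔ k ∣ b := by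
    intro k
    constructor
    · intro h
      have hk0 : k ≠ 0 := by rintro rfl; simp at h; omega
      -- divide out by gcd
      obtain ⟨g, k', b', hg, hcop, rfl, rfl⟩ := Nat.exists_coprime' (m := k) (n := b) (Nat.gcd_pos_of_pos_right _ hb)
      have h1 : k' ^ 2 ∣ b' ^ 2 * a := by
        have : g ^ 2 * k' ^ 2 ∣ g ^ 2 * (b' ^ 2 * a) := by
          convert h using 1
          · ring
          · rw [← hab]; ring
        exact Nat.dvd_of_mul_dvd_mul_left (by positivity) this
      have h2 : k' ^ 2 ∣ a := (Nat.Coprime.pow 2 2 hcop).dvd_of_dvd_mul_left h1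
      have h3 : k' = 1 := by
        have := hsq k' (by rwa [← sq])
        simpa using this
      rw [h3, one_mul]; exact dvd_mul_left _ _
    · intro h
      rw [← hab]
      exact (pow_dvd_pow_of_dvd h 2).mul_right a
  have hbN : b ≤ N := by
    refine le_trans ?_ hN
    rw [← hab]
    nlinarith [Nat.mul_le_mul hb ha, Nat.mul_le_mul (Nat.mul_le_mul (le_refl b) hb) ha]
  rw [← Finset.sum_filter]
  have hf : (Finset.Icc 1 N).filter (fun k => k ^ 2 ∣ d) = b.divisors := by
    ext k
    simp only [Finset.mem_filter, Finset.mem_Icc, key, Nat.mem_divisors]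
    constructor
    · rintro ⟨_, h⟩; exact ⟨h, by omega⟩
    · rintro ⟨h, _⟩
      exact ⟨⟨Nat.pos_of_dvd_of_pos h hb, (Nat.le_of_dvd hb h).trans hbN⟩, h⟩
  rw [hf, sum_moebius_div, ArithmeticFunction.moebius_sq]
  congr 1
  apply propext
  constructor
  · intro h
    have := h b (by rw [← sq]; exact (key b).2 dvd_rfl)
    simpa using this
  · intro h
    rw [h] at hab
    rw [← hab]; simpa using hsq

lemma sum_min_aux (N B : ℝ) (hN : 0 ≤ N) (hB : 0 < B) (K : ℕ) :
    ∑ k ∈ Finset.Icc 1 K, min (N / (k : ℝ) ^ 2) B ≤ 2 * (√N * √B) := by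
  obtain ⟨s, hs, rfl⟩ : ∃ s : ℝ, 0 ≤ s ∧ N = s ^ 2 := ⟨√N, Real.sqrt_nonneg _, (Real.sq_sqrt hN).symm⟩
  obtain ⟨b, hb, rfl⟩ : ∃ b : ℝ, 0 < b ∧ B = b ^ 2 := ⟨√B, Real.sqrt_pos.2 hB, (Real.sq_sqrt hB.le).symm⟩
  rw [Real.sqrt_sq hs, Real.sqrt_sq hb.le]
  have main : ∀ K : ℕ, ∑ k ∈ Finset.Icc 1 K, min (s ^ 2 / (k : ℝ) ^ 2) (b ^ 2) ≤
      if b * K ≤ s then b ^ 2 * K else 2 * (s * b) - s ^ 2 / K := by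
    intro K
    induction K with
    | zero => simp [hs]
    | succ K ih =>
      rw [Finset.sum_Icc_succ_top (by omega)]
      have hK : (0 : ℝ) ≤ K := by positivity
      push_cast
      by_cases h1 : b * ((K : ℝ) + 1) ≤ s
      · rw [if_pos h1]
        rw [if_pos (by nlinarith)] at ih
        have := min_le_right (s ^ 2 / ((K : ℝ) + 1) ^ 2) (b ^ 2)
        nlinarith
      · rw [if_neg h1]
        push Not at h1
        have hm := min_le_left (s ^ 2 / ((K : ℝ) + 1) ^ 2) (b ^ 2)
        split_ifs at ih with h2
        · have : b ^ 2 * K + s ^ 2 / ((K : ℝ) + 1) ^ 2 ≤ 2 * (s * b) - s ^ 2 / (K + 1) := by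
            rw [← sub_nonneg]
            have e : 2 * (s * b) - s ^ 2 / (K + 1) - (b ^ 2 * K + s ^ 2 / ((K : ℝ) + 1) ^ 2)
              = (b * (K + 1) - s) * (s * (K + 2) - b * (K + 1) * K) / ((K : ℝ) + 1) ^ 2 := by
              field_simp; ring
            rw [e]
            apply div_nonneg _ (by positivity)
            apply mul_nonneg (by linarith)
            nlinarith [mul_le_mul_of_nonneg_right h2 hK]
          linarith
        · push Not at h2
          have hK0 : 0 < (K : ℝ) := by
            rcases hK.eq_or_lt with h | h
            · rw [← h] at h2; linarith
            · exact h
          have : s ^ 2 / ((K : ℝ) + 1) ^ 2 ≤ s ^ 2 / K - s ^ 2 / (K + 1) := by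
            rw [show s ^ 2 / (K:ℝ) - s ^ 2 / (K + 1) = s ^ 2 / (K * (K + 1)) by field_simp; ring]
            gcongr
            nlinarith
          linarith
  refine (main K).trans ?_
  split_ifs with h
  · nlinarith
  · have : 0 ≤ s ^ 2 / (K : ℝ) := by positivity
    linarith

/-- **Lemma (character sums over squarefree integers, Lemma LemmaSqfChar).**
Let `m > 1` and let `χ` be a non-principal Dirichlet character modulo `m` (not
necessarily primitive). Then for every real `x ≥ 1`,
`|∑_{d ≤ x} μ²(d) χ(d)| ≤ 5 · x^(1/2) · m^(1/4) · (log m)^(1/2)`. -/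
theorem squarefree_character_sum_bound (m : ℕ) (hm : 1 < m)
    (χ : DirichletCharacter ℂ m) (hχ : χ ≠ 1) (x : ℝ) (hx : 1 ≤ x) :
    ‖∑ d ∈ Finset.Icc 1 ⌊x⌋₊,
        ((ArithmeticFunction.moebius d : ℤ) : ℂ) ^ 2 * χ (d : ZMod m)‖
      ≤ 5 * x ^ ((1 : ℝ) / 2) * (m : ℝ) ^ ((1 : ℝ) / 4) *
          (Real.log m) ^ ((1 : ℝ) / 2) := by
  set N := ⌊x⌋₊ with hNdef
  have hNx : (N : ℝ) ≤ x := Nat.floor_le (by linarith)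
  have hm0 : (0 : ℝ) < m := by exact_mod_cast (by omega : 0 < m)
  have hlog : 0 < Real.log m := Real.log_pos (by exact_mod_cast hm)
  have hexp : ∑ d ∈ Finset.Icc 1 N, ((ArithmeticFunction.moebius d : ℤ) : ℂ) ^ 2 * χ (d : ZMod m)
      = ∑ k ∈ Finset.Icc 1 N, ∑ n ∈ Finset.Icc 1 (N / k ^ 2),
          ((ArithmeticFunction.moebius k : ℤ) : ℂ) * χ ((k ^ 2 * n : ℕ) : ZMod m) := by
    have h1 : ∀ d ∈ Finset.Icc 1 N, ((ArithmeticFunction.moebius d : ℤ) : ℂ) ^ 2 * χ (d : ZMod m)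
        = ∑ k ∈ Finset.Icc 1 N, if k ^ 2 ∣ d then ((ArithmeticFunction.moebius k : ℤ) : ℂ) * χ (d : ZMod m) else 0 := by
      intro d hd
      rw [Finset.mem_Icc] at hd
      have h2 := congrArg (Int.cast : ℤ → ℂ) (moebius_sq_sum d N hd.1 hd.2)
      push_cast at h2
      rw [h2, Finset.sum_mul]
      refine Finset.sum_congr rfl fun k _ => ?_
      split_ifs <;> simp
    rw [Finset.sum_congr rfl h1, Finset.sum_comm]
    refine Finset.sum_congr rfl fun k hk => ?_
    rw [Finset.mem_Icc] at hk
    exact sum_multiples_aux N (k ^ 2) (pow_pos hk.1 2)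
      (fun d => ((ArithmeticFunction.moebius k : ℤ) : ℂ) * χ (d : ZMod m))
  rw [hexp]
  set B : ℝ := 6 * √(m : ℝ) * Real.log m with hB
  have hBpos : 0 < B := by positivity
  have hterm : ‖∑ k ∈ Finset.Icc 1 N, ∑ n ∈ Finset.Icc 1 (N / k ^ 2),
          ((ArithmeticFunction.moebius k : ℤ) : ℂ) * χ ((k ^ 2 * n : ℕ) : ZMod m)‖
      ≤ ∑ k ∈ Finset.Icc 1 N, min ((N : ℝ) / (k : ℝ) ^ 2) B := by
    refine norm_sum_le_of_le _ fun k _ => ?_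
    simp_rw [Nat.cast_mul, map_mul, ← mul_assoc]
    rw [← Finset.mul_sum, norm_mul, norm_mul]
    have a1 := norm_moebius_le k
    have a2 := DirichletCharacter.norm_le_one χ ((k ^ 2 : ℕ) : ZMod m)
    have a4 := mul_le_one₀ a1 (norm_nonneg _) a2
    refine (mul_le_of_le_one_left (norm_nonneg _) a4).trans (le_min ?_ (pv_general hm χ hχ _))
    calc _ ≤ ∑ n ∈ Finset.Icc 1 (N / k ^ 2), (1 : ℝ) :=
          norm_sum_le_of_le _ fun n _ => DirichletCharacter.norm_le_one χ _
      _ = ((N / k ^ 2 : ℕ) : ℝ) := by simp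
      _ ≤ _ := by
        refine Nat.cast_div_le.trans (le_of_eq ?_)
        push_cast; rfl
  refine hterm.trans ((sum_min_aux N B (by positivity) hBpos N).trans ?_)
  have e1 : √B = √6 * (m : ℝ) ^ ((1 : ℝ) / 4) * (Real.log m) ^ ((1 : ℝ) / 2) := by
    rw [hB, Real.sqrt_mul (by positivity), Real.sqrt_mul (by norm_num)]
    congr 1
    · congr 1
      rw [Real.sqrt_eq_rpow, Real.sqrt_eq_rpow, ← Real.rpow_mul hm0.le]
      norm_num
    · rw [Real.sqrt_eq_rpow]
  have e2 : √(N : ℝ) ≤ x ^ ((1 : ℝ) / 2) := by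
    rw [← Real.sqrt_eq_rpow]; exact Real.sqrt_le_sqrt hNx
  have e3 : √(6 : ℝ) ≤ 5 / 2 := by
    rw [Real.sqrt_le_left (by norm_num)]; norm_num
  rw [e1]
  calc _ ≤ 2 * (x ^ ((1 : ℝ) / 2) * (5 / 2 * (m : ℝ) ^ ((1 : ℝ) / 4) * (Real.log m) ^ ((1 : ℝ) / 2))) := by
        gcongr
    _ = _ := by ring
end

section
/- There is an absolute constant C > 0 with the following property. Let a be an odd residue class modulo 4, let m ≥ 2 be an integer, and let x > 1 be a real number. Then | ∑_{d ≤ x, gcd(d,m)=1, d ≡ a (mod 4)} μ²(d) − x / (2 ζ(2) ∏_{p | 2m} (1 + 1/p)) | ≤ C · x^{1/2} m^{1/4} (log m)^{1/2}, where the sum is over squarefree positive integers d ≤ x coprime to m with d ≡ a (mod 4), ζ(2) = π²/6, and the product runs over the distinct primes p dividing 2m. -/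
noncomputable def cntNP (r : ℕ) (P : Finset ℕ) (y : ℝ) : ℕ :=
  (Finset.filter (fun n : ℕ => n % 4 = r ∧ ∀ p ∈ P, ¬ p ∣ n) (Finset.Icc 1 ⌊y⌋₊)).card

lemma base_card (r : ℕ) (hr : r = 1 ∨ r = 3) (Y : ℕ) :
    (Finset.filter (fun n : ℕ => n % 4 = r) (Finset.Icc 1 Y)).card = (Y + 4 - r) / 4 := by
  induction Y with
  | zero => rcases hr with rfl | rfl <;> rfl
  | succ k ih =>
    rw [← Finset.insert_Icc_right_eq_Icc_add_one (by omega), Finset.filter_insert]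
    split_ifs with h
    · rw [Finset.card_insert_of_notMem (by simp), ih]; omega
    · rw [ih]; omega

lemma cntNP_bound (P : Finset ℕ) (hP : ∀ p ∈ P, p.Prime ∧ p ≠ 2) :
    ∀ (r : ℕ) (_ : r = 1 ∨ r = 3) (y : ℝ) (_ : 0 ≤ y),
      |(cntNP r P y : ℝ) - y / 4 * ∏ p ∈ P, (1 - 1 / (p : ℝ))| ≤ 2 ^ P.card := by
  induction P using Finset.induction_on with
  | empty =>
    intro r hr y hy
    have h := base_card r hr ⌊y⌋₊
    have h1 := Nat.floor_le hy
    have h2 := Nat.lt_floor_add_one y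
    simp only [cntNP, Finset.notMem_empty, false_imp_iff, implies_true, and_true, h,
      Finset.prod_empty, Finset.card_empty, pow_zero, mul_one]
    set Y := ⌊y⌋₊
    have h3 : Y ≤ 4 * ((Y + 4 - r) / 4) + 2 := by omega
    have h4 : 4 * ((Y + 4 - r) / 4) ≤ Y + 3 := by omega
    have h3' : (Y : ℝ) ≤ 4 * (((Y + 4 - r) / 4 : ℕ) : ℝ) + 2 := by exact_mod_cast h3
    have h4' : 4 * (((Y + 4 - r) / 4 : ℕ) : ℝ) ≤ Y + 3 := by exact_mod_cast h4
    rw [abs_le]; constructor <;> linarith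
  | insert q P hq ih =>
    intro r hr y hy
    obtain ⟨hqp, hq2⟩ := hP q (by simp)
    have ih' := ih (fun p hp => hP p (by simp [hp]))
    have hqodd : q % 2 = 1 := (hqp.eq_two_or_odd).resolve_left hq2
    have hq0 : (0 : ℝ) < q := by exact_mod_cast hqp.pos
    set r' := (q * r) % 4 with hr'
    have hr'' : r' = 1 ∨ r' = 3 := by
      have : q % 4 = 1 ∨ q % 4 = 3 := by omega
      rw [hr', Nat.mul_mod]
      rcases this with h | h <;> rcases hr with h' | h' <;> simp [h, h']
    have key : cntNP r P y = cntNP r (insert q P) y + cntNP r' P (y / q) := by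
      have e1 : cntNP r P y = ((Finset.filter (fun n : ℕ => n % 4 = r ∧ ∀ p ∈ P, ¬ p ∣ n) (Finset.Icc 1 ⌊y⌋₊)).filter (fun n => ¬ q ∣ n)).card + ((Finset.filter (fun n : ℕ => n % 4 = r ∧ ∀ p ∈ P, ¬ p ∣ n) (Finset.Icc 1 ⌊y⌋₊)).filter (fun n => q ∣ n)).card := by
        rw [add_comm, Finset.card_filter_add_card_filter_not]; rfl
      rw [e1]
      congr 1
      · unfold cntNP
        congr 1
        ext n
        simp only [Finset.mem_filter, Finset.mem_insert, forall_eq_or_imp]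
        tauto
      · unfold cntNP
        symm
        apply Finset.card_bij (fun k _ => q * k)
        · intro k hk
          simp only [Finset.mem_filter, Finset.mem_Icc] at hk ⊢
          obtain ⟨⟨hk1, hk2⟩, hk3, hk4⟩ := hk
          have hk2' : (k : ℝ) ≤ y / q := (Nat.le_floor_iff (by positivity)).1 hk2
          refine ⟨⟨⟨?_, ?_⟩, ?_, ?_⟩, dvd_mul_right _ _⟩
          · exact Nat.mul_pos hqp.pos hk1
          · apply Nat.le_floor
            rw [le_div_iff₀ hq0] at hk2'
            push_cast; linarith
          · have : q % 4 = 1 ∨ q % 4 = 3 := by omega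
            rw [hr', Nat.mul_mod] at hk3
            rw [Nat.mul_mod, hk3]
            rcases this with h | h <;> rcases hr with h' | h' <;> simp [h, h']
          · intro p hp hd
            rcases ((hP p (by simp [hp])).1.dvd_mul).1 hd with h | h
            · have := (Nat.prime_dvd_prime_iff_eq (hP p (by simp [hp])).1 hqp).1 h
              exact hq (this ▸ hp)
            · exact hk4 p hp h
        · intro k _ l _ h
          exact Nat.eq_of_mul_eq_mul_left hqp.pos h
        · intro n hn
          simp only [Finset.mem_filter, Finset.mem_Icc] at hn
          obtain ⟨⟨⟨hn1, hn2⟩, hn3, hn4⟩, k, rfl⟩ := hn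
          refine ⟨k, ?_, rfl⟩
          simp only [Finset.mem_filter, Finset.mem_Icc]
          refine ⟨⟨Nat.pos_of_mul_pos_left hn1, ?_⟩, ?_, ?_⟩
          · apply Nat.le_floor
            rw [le_div_iff₀ hq0]
            have := (Nat.le_floor_iff hy).1 hn2
            push_cast at this; linarith
          · have : q % 4 = 1 ∨ q % 4 = 3 := by omega
            have hk4 : k % 4 = 0 ∨ k % 4 = 1 ∨ k % 4 = 2 ∨ k % 4 = 3 := by omega
            rw [Nat.mul_mod] at hn3
            rw [hr', Nat.mul_mod, ← hn3]
            rcases this with h | h <;> rcases hk4 with h' | h' | h' | h' <;> simp [h, h']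
          · intro p hp hd
            exact hn4 p hp (hd.mul_left _)
    have b1 := ih' r hr y hy
    have b2 := ih' r' hr'' (y / q) (by positivity)
    rw [Finset.prod_insert hq, Finset.card_insert_of_notMem hq, pow_succ]
    have key' : (cntNP r (insert q P) y : ℝ) = cntNP r P y - cntNP r' P (y / q) := by
      rw [key]; push_cast; ring
    have e : (cntNP r (insert q P) y : ℝ) - y / 4 * ((1 - 1 / (q : ℝ)) * ∏ p ∈ P, (1 - 1 / (p : ℝ)))
        = ((cntNP r P y : ℝ) - y / 4 * ∏ p ∈ P, (1 - 1 / (p : ℝ)))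
          - ((cntNP r' P (y / q) : ℝ) - y / q / 4 * ∏ p ∈ P, (1 - 1 / (p : ℝ))) := by
      rw [key']; ring
    rw [e]
    refine (abs_sub _ _).trans ?_
    linarith

lemma sum_mu_sq (n B : ℕ) (hn : 0 < n) (hB : ∀ b, b ^ 2 ∣ n → b ≤ B) :
    ∑ b ∈ (Finset.Icc 1 B).filter (fun b => b ^ 2 ∣ n), ArithmeticFunction.moebius b
      = if Squarefree n then 1 else 0 := by
  obtain ⟨d, c, hd, hc, h, hsq⟩ := Nat.sq_mul_squarefree_of_pos hn
  have hiff : ∀ b, b ^ 2 ∣ n ↔ b ∣ c := by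
    intro b
    constructor
    · intro hb
      have hb0 : b ≠ 0 := by rintro rfl; simp at hb; omega
      rw [← Nat.factorization_le_iff_dvd hb0 (by omega)]
      intro p
      have h1 := (Nat.factorization_le_iff_dvd (pow_ne_zero 2 hb0) (by omega)).2 hb p
      rw [← h, Nat.factorization_mul (by positivity) (by omega)] at h1
      have h2 := hsq.natFactorization_le_one p
      simp only [Nat.factorization_pow, Finsupp.smul_apply, Finsupp.add_apply, smul_eq_mul] at h1
      omega
    · intro hb
      rw [← h]
      exact (pow_dvd_pow_of_dvd hb 2).mul_right d
  have : (Finset.Icc 1 B).filter (fun b => b ^ 2 ∣ n) = c.divisors := by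
    ext b
    simp only [Finset.mem_filter, Finset.mem_Icc, hiff, Nat.mem_divisors]
    constructor
    · rintro ⟨_, h⟩; exact ⟨h, by omega⟩
    · rintro ⟨h, _⟩; exact ⟨⟨Nat.pos_of_dvd_of_pos h (by omega), hB b ((hiff b).2 h)⟩, h⟩
  rw [this, ← ArithmeticFunction.coe_mul_zeta_apply, ArithmeticFunction.moebius_mul_coe_zeta, ArithmeticFunction.one_apply]
  have : c = 1 ↔ Squarefree n := by
    constructor
    · rintro rfl; rw [← h]; simpa using hsq
    · intro hs
      have := hs c (by rw [← h, pow_two]; exact dvd_mul_right _ _)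
      exact Nat.isUnit_iff.1 this
  simp only [this]

lemma two_pow_omega (m : ℕ) (hm : m ≠ 0) :
    (2 : ℝ) ^ m.primeFactors.card ≤ 2 ^ 16 * (m : ℝ) ^ ((1 : ℝ) / 4) := by
  have h1 : (2 : ℝ) ^ m.primeFactors.card =
      (∏ p ∈ m.primeFactors.filter (· < 16), (2:ℝ)) * ∏ p ∈ m.primeFactors.filter (¬ · < 16), (2:ℝ) := by
    rw [Finset.prod_filter_mul_prod_filter_not, Finset.prod_const]
  rw [h1]
  gcongr
  · rw [Finset.prod_const]
    apply pow_le_pow_right₀ (by norm_num)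
    calc _ ≤ (Finset.range 16).card := Finset.card_le_card (by intro p; simp)
      _ = 16 := by simp
  · calc _ ≤ ∏ p ∈ m.primeFactors.filter (¬ · < 16), (p : ℝ) ^ ((1 : ℝ) / 4) := by
          apply Finset.prod_le_prod
          · intros; norm_num
          · intro p hp
            simp only [Finset.mem_filter, not_lt] at hp
            have : (16 : ℝ) ≤ p := by exact_mod_cast hp.2
            calc (2 : ℝ) = (16 : ℝ) ^ ((1 : ℝ) / 4) := by
                  rw [show (16 : ℝ) = 2 ^ (4 : ℝ) by norm_num, ← Real.rpow_mul (by norm_num)]; norm_num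
              _ ≤ _ := by gcongr
      _ = (∏ p ∈ m.primeFactors.filter (¬ · < 16), (p : ℝ)) ^ ((1 : ℝ) / 4) := by
          rw [Real.finsetProd_rpow]; intros; positivity
      _ ≤ _ := by
          gcongr
          rw [← Nat.cast_prod]
          exact_mod_cast Nat.le_of_dvd (by omega) ((Finset.prod_dvd_prod_of_subset _ _ _ (Finset.filter_subset _ _)).trans (Nat.prod_primeFactors_dvd m))

noncomputable def muc (M b : ℕ) : ℝ :=
  if Nat.Coprime b M then (ArithmeticFunction.moebius b : ℝ) else 0

lemma muc_abs (M b : ℕ) : |muc M b| ≤ 1 := by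
  unfold muc; split_ifs
  · exact_mod_cast ArithmeticFunction.abs_moebius_le_one
  · simp

lemma muc_hasSum (M : ℕ) (hM : M ≠ 0) :
    HasSum (fun b : ℕ => muc M b / (b : ℝ) ^ 2)
      ((Real.pi ^ 2 / 6 * ∏ p ∈ M.primeFactors, (1 - 1 / (p : ℝ) ^ 2))⁻¹) := by
  have : NeZero M := ⟨hM⟩
  let χ : DirichletCharacter ℂ M := 1
  have hs : 1 < (2 : ℂ).re := by norm_num
  have h1 := DirichletCharacter.LSeries.mul_mu_eq_one χ hs
  rw [← DirichletCharacter.LFunction_eq_LSeries χ hs] at h1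
  have h2 := DirichletCharacter.LFunctionTrivChar_eq_mul_riemannZeta (N := M) (s := 2) (by norm_num)
  rw [DirichletCharacter.LFunctionTrivChar] at h2
  rw [h2, riemannZeta_two] at h1
  have h3 := (DirichletCharacter.LSeriesSummable_mul χ
    (ArithmeticFunction.LSeriesSummable_moebius_iff.mpr hs)).LSeriesHasSum
  rw [eq_inv_of_mul_eq_one_right h1] at h3
  rw [← Complex.hasSum_ofReal]
  unfold LSeriesHasSum at h3
  convert h3 using 1
  · ext b
    rcases eq_or_ne b 0 with rfl | hb
    · simp
    · rw [LSeries.term_of_ne_zero hb]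
      simp only [muc, Pi.mul_apply, χ]
      split_ifs with h
      · rw [MulChar.one_apply ((ZMod.isUnit_iff_coprime b M).2 h)]
        simp
      · rw [MulChar.map_nonunit _ (fun h' => h ((ZMod.isUnit_iff_coprime b M).1 h'))]
        simp
  · push_cast
    rw [mul_comm]
    congr 2
    apply Finset.prod_congr rfl
    intro p _
    rw [Complex.cpow_neg, one_div]
    simp

lemma muc_tail (M B : ℕ) (hM : M ≠ 0) (hB : 1 ≤ B) :
    |∑ b ∈ Finset.Icc 1 B, muc M b / (b : ℝ) ^ 2 -
      ((Real.pi ^ 2 / 6 * ∏ p ∈ M.primeFactors, (1 - 1 / (p : ℝ) ^ 2))⁻¹)| ≤ 1 / B := by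
  have h := (muc_hasSum M hM).tendsto_sum_nat
  have h' := (h.const_sub (∑ b ∈ Finset.Icc 1 B, muc M b / (b : ℝ) ^ 2)).abs
  refine le_of_tendsto h' ?_
  filter_upwards [Filter.eventually_ge_atTop (B + 1)] with n hn
  have e : ∑ b ∈ Finset.Icc 1 B, muc M b / (b : ℝ) ^ 2 = ∑ b ∈ Finset.range (B+1), muc M b / (b : ℝ) ^ 2 := by
    rw [Finset.range_eq_Ico, Finset.sum_eq_sum_Ico_succ_bot (by omega)]
    simp
    rfl
  rw [e, abs_sub_comm, ← Finset.sum_Ico_eq_sub _ hn]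
  refine (Finset.abs_sum_le_sum_abs _ _).trans ?_
  calc _ ≤ ∑ b ∈ Finset.Ioc B (n-1), ((b : ℝ) ^ 2)⁻¹ := by
        have : Finset.Ico (B+1) n = Finset.Ioc B (n-1) := by ext; simp; omega
        rw [this]
        apply Finset.sum_le_sum
        intro b _
        rw [abs_div, abs_of_nonneg (by positivity : (0:ℝ) ≤ (b:ℝ)^2), div_eq_mul_inv]
        exact mul_le_of_le_one_left (by positivity) (muc_abs _ _)
    _ ≤ (B : ℝ)⁻¹ - ((n-1 : ℕ) : ℝ)⁻¹ := sum_Ioc_inv_sq_le_sub (by omega) (by omega)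
    _ ≤ 1 / B := by
        rw [one_div]; have : 0 ≤ ((n-1 : ℕ) : ℝ)⁻¹ := by positivity
        linarith

lemma cop_iff (m d : ℕ) (hm : m ≠ 0) (hd : d % 2 = 1) :
    Nat.Coprime d (2 * m) ↔ ∀ p ∈ (2 * m).primeFactors.erase 2, ¬ p ∣ d := by
  constructor
  · intro h p hp hpd
    simp only [Finset.mem_erase, Nat.mem_primeFactors] at hp
    exact Nat.not_coprime_of_dvd_of_dvd hp.2.1.one_lt hpd hp.2.2.1 h
  · intro h
    apply Nat.coprime_of_dvd
    intro p hp hpd hpm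
    refine h p ?_ hpd
    simp only [Finset.mem_erase, Nat.mem_primeFactors]
    refine ⟨?_, hp, hpm, by omega⟩
    rintro rfl; omega

lemma count_eq (a m : ℕ) (x : ℝ) (ha : Odd a) (hm : 2 ≤ m) (hx : 1 < x) :
    (({d : ℕ | 0 < d ∧ (d : ℝ) ≤ x ∧ Squarefree d ∧ Nat.Coprime d m ∧
            d % 4 = a % 4}.ncard : ℝ)) =
    ∑ b ∈ Finset.Icc 1 ⌊Real.sqrt x⌋₊, muc (2 * m) b *
      (cntNP (a % 4) ((2 * m).primeFactors.erase 2) (x / (b : ℝ) ^ 2) : ℝ) := by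
  have ha2 : a % 2 = 1 := Nat.odd_iff.1 ha
  have hx0 : 0 ≤ x := by linarith
  set P := (2 * m).primeFactors.erase 2 with hP
  set B := ⌊Real.sqrt x⌋₊ with hB
  set G := Finset.filter (fun n : ℕ => n % 4 = a % 4 ∧ ∀ p ∈ P, ¬ p ∣ n) (Finset.Icc 1 ⌊x⌋₊) with hG
  have hset : {d : ℕ | 0 < d ∧ (d : ℝ) ≤ x ∧ Squarefree d ∧ Nat.Coprime d m ∧
            d % 4 = a % 4} = ↑(G.filter Squarefree) := by
    ext d
    simp only [Set.mem_ofPred_eq, Finset.coe_filter, hG, Finset.mem_filter, Finset.mem_Icc,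
      Nat.le_floor_iff hx0]
    have key : d % 4 = a % 4 → (Nat.Coprime d m ↔ ∀ p ∈ P, ¬ p ∣ d) := by
      intro h
      rw [hP, ← cop_iff m d (by omega) (by omega)]
      have h2 : Nat.Coprime d 2 := (Nat.coprime_two_right).2 (Nat.odd_iff.2 (by omega))
      rw [Nat.coprime_mul_iff_right]
      tauto
    constructor
    · rintro ⟨h1, h2, h3, h4, h5⟩
      exact ⟨⟨⟨h1, h2⟩, h5, (key h5).1 h4⟩, h3⟩
    · rintro ⟨⟨⟨h1, h2⟩, h5, h4⟩, h3⟩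
      exact ⟨h1, h2, h3, (key h5).2 h4, h5⟩
  rw [hset, Set.ncard_coe_finset, Finset.card_filter, Nat.cast_sum]
  have step1 : ∀ d ∈ G, (((if Squarefree d then 1 else 0 : ℕ)) : ℝ) =
      ∑ b ∈ Finset.Icc 1 B, if b ^ 2 ∣ d then (ArithmeticFunction.moebius b : ℝ) else 0 := by
    intro d hd
    simp only [hG, Finset.mem_filter, Finset.mem_Icc, Nat.le_floor_iff hx0] at hd
    have := sum_mu_sq d B (by omega) (by
      intro b hb
      apply Nat.le_floor
      apply Real.le_sqrt_of_sq_le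
      have := Nat.le_of_dvd (by omega) hb
      calc (b : ℝ) ^ 2 ≤ d := by exact_mod_cast this
        _ ≤ x := hd.1.2)
    rw [← Finset.sum_filter]
    have h2 := congrArg (fun z : ℤ => (z : ℝ)) this
    push_cast at h2 ⊢
    exact h2.symm
  rw [Finset.sum_congr rfl step1, Finset.sum_comm]
  apply Finset.sum_congr rfl
  intro b hb
  have hb1 := (Finset.mem_Icc.1 hb).1
  have hb0 : (0 : ℝ) < (b : ℝ) ^ 2 := by positivity
  rw [← Finset.sum_filter, Finset.sum_const, nsmul_eq_mul, mul_comm]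
  unfold muc
  split_ifs with hc
  · congr 2
    have hbo : b % 2 = 1 := Nat.odd_iff.1 (Nat.coprime_two_right.1 (Nat.Coprime.coprime_mul_right_right hc))
    have hb4 : b ^ 2 % 4 = 1 := by
      have : b % 4 = 1 ∨ b % 4 = 3 := by omega
      rw [Nat.pow_mod]; rcases this with h | h <;> simp [h]
    have hcP := (cop_iff m b (by omega) hbo).1 hc
    unfold cntNP
    symm
    apply Finset.card_bij (fun k _ => b ^ 2 * k)
    · intro k hk
      simp only [hG, Finset.mem_filter, Finset.mem_Icc, Nat.le_floor_iff hx0,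
        Nat.le_floor_iff (show 0 ≤ x / (b : ℝ) ^ 2 by positivity)] at hk ⊢
      obtain ⟨⟨hk1, hk2⟩, hk3, hk4⟩ := hk
      refine ⟨⟨⟨Nat.mul_pos (by positivity) hk1, ?_⟩, ?_, ?_⟩, dvd_mul_right _ _⟩
      · rw [le_div_iff₀ hb0] at hk2
        push_cast; linarith
      · rw [Nat.mul_mod, hb4, hk3]; simp
      · intro p hp hd
        have hpp : p.Prime := Nat.prime_of_mem_primeFactors (Finset.mem_of_mem_erase hp)
        rcases hpp.dvd_mul.1 hd with h | h
        · exact hcP p hp (hpp.dvd_of_dvd_pow h)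
        · exact hk4 p hp h
    · intro k _ l _ h
      exact Nat.eq_of_mul_eq_mul_left (by positivity) h
    · intro n hn
      simp only [hG, Finset.mem_filter, Finset.mem_Icc, Nat.le_floor_iff hx0] at hn
      obtain ⟨⟨⟨hn1, hn2⟩, hn3, hn4⟩, k, rfl⟩ := hn
      refine ⟨k, ?_, rfl⟩
      simp only [Finset.mem_filter, Finset.mem_Icc,
        Nat.le_floor_iff (show 0 ≤ x / (b : ℝ) ^ 2 by positivity)]
      refine ⟨⟨Nat.pos_of_mul_pos_left hn1, ?_⟩, ?_, ?_⟩
      · rw [le_div_iff₀ hb0]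
        push_cast at hn2; linarith
      · rw [Nat.mul_mod, hb4] at hn3
        omega
      · intro p hp hd
        exact hn4 p hp (hd.mul_left _)
  · rw [zero_mul, mul_eq_zero]
    by_cases hmu : Finset.filter (fun d => b ^ 2 ∣ d) G = ∅
    · right; simp [hmu]
    · exfalso
      obtain ⟨d, hd⟩ := Finset.nonempty_iff_ne_empty.2 hmu
      simp only [hG, Finset.mem_filter, Finset.mem_Icc] at hd
      obtain ⟨⟨_, hd3, hd4⟩, hbd⟩ := hd
      have hcd := (cop_iff m d (by omega) (by omega)).2 hd4
      exact hc (Nat.Coprime.coprime_dvd_left ((dvd_pow_self b two_ne_zero).trans hbd) hcd)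

lemma main_term (m : ℕ) (hm : 2 ≤ m) (x : ℝ) :
    x / (2 * (Real.pi ^ 2 / 6) * ∏ p ∈ (2 * m).primeFactors, (1 + 1 / (p : ℝ))) =
    x / 4 * (∏ p ∈ (2 * m).primeFactors.erase 2, (1 - 1 / (p : ℝ))) *
      ((Real.pi ^ 2 / 6 * ∏ p ∈ (2 * m).primeFactors, (1 - 1 / (p : ℝ) ^ 2))⁻¹) := by
  have h2 : 2 ∈ (2 * m).primeFactors := by
    simp only [Nat.mem_primeFactors]; exact ⟨Nat.prime_two, by simp, by omega⟩
  have e1 : ∏ p ∈ (2 * m).primeFactors, (1 - 1 / (p : ℝ) ^ 2) =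
      (∏ p ∈ (2 * m).primeFactors, (1 - 1 / (p : ℝ))) * ∏ p ∈ (2 * m).primeFactors, (1 + 1 / (p : ℝ)) := by
    rw [← Finset.prod_mul_distrib]
    apply Finset.prod_congr rfl; intros; ring
  have e2 : ∏ p ∈ (2 * m).primeFactors, (1 - 1 / (p : ℝ)) = 1 / 2 *
      ∏ p ∈ (2 * m).primeFactors.erase 2, (1 - 1 / (p : ℝ)) := by
    rw [← Finset.mul_prod_erase _ _ h2]; norm_num
  have p1 : (0:ℝ) < ∏ p ∈ (2 * m).primeFactors.erase 2, (1 - 1 / (p : ℝ)) := by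
    apply Finset.prod_pos
    intro p hp
    have hpp : p.Prime := Nat.prime_of_mem_primeFactors (Finset.mem_of_mem_erase hp)
    have : (1 : ℝ) < p := by exact_mod_cast hpp.one_lt
    rw [sub_pos, div_lt_one (by linarith)]; exact this
  have p2 : (0:ℝ) < ∏ p ∈ (2 * m).primeFactors, (1 + 1 / (p : ℝ)) := by
    apply Finset.prod_pos; intros; positivity
  rw [e1, e2]
  have := Real.pi_pos
  field_simp
  ring

lemma main_bound (a m : ℕ) (x : ℝ) (ha : Odd a) (hm : 2 ≤ m) (hx : 1 < x) :
    |({d : ℕ | 0 < d ∧ (d : ℝ) ≤ x ∧ Squarefree d ∧ Nat.Coprime d m ∧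
            d % 4 = a % 4}.ncard : ℝ)
          - x / (2 * (Real.pi ^ 2 / 6) * ∏ p ∈ (2 * m).primeFactors, (1 + 1 / (p : ℝ)))|
      ≤ Real.sqrt x * 2 ^ m.primeFactors.card + Real.sqrt x / 2 := by
  have ha2 : a % 2 = 1 := Nat.odd_iff.1 ha
  rw [count_eq a m x ha hm hx, main_term m hm]
  set P := (2 * m).primeFactors.erase 2 with hP
  set B := ⌊Real.sqrt x⌋₊ with hB
  set Q := ∏ p ∈ P, (1 - 1 / (p : ℝ)) with hQ
  set Z := (Real.pi ^ 2 / 6 * ∏ p ∈ (2 * m).primeFactors, (1 - 1 / (p : ℝ) ^ 2))⁻¹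
  have hPp : ∀ p ∈ P, p.Prime ∧ p ≠ 2 := fun p hp =>
    ⟨Nat.prime_of_mem_primeFactors (Finset.mem_of_mem_erase hp), Finset.ne_of_mem_erase hp⟩
  have hPc : P.card ≤ m.primeFactors.card := by
    apply Finset.card_le_card
    intro p hp
    have h1 := hPp p hp
    have h2 := Nat.dvd_of_mem_primeFactors (Finset.mem_of_mem_erase hp)
    rw [Nat.mem_primeFactors]
    refine ⟨h1.1, ?_, by omega⟩
    rcases h1.1.dvd_mul.1 h2 with h | h
    · exact absurd ((Nat.prime_dvd_prime_iff_eq h1.1 Nat.prime_two).1 h) h1.2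
    · exact h
  have hQ0 : 0 ≤ Q ∧ Q ≤ 1 := by
    have hh : ∀ p ∈ P, 0 ≤ 1 - 1 / (p : ℝ) ∧ 1 - 1 / (p : ℝ) ≤ 1 := by
      intro p hp
      have : (1 : ℝ) < p := by exact_mod_cast (hPp p hp).1.one_lt
      constructor
      · rw [sub_nonneg, div_le_one (by linarith)]; exact this.le
      · have : 0 ≤ 1 / (p : ℝ) := by positivity
        linarith
    exact ⟨Finset.prod_nonneg fun p hp => (hh p hp).1,
      Finset.prod_le_one (fun p hp => (hh p hp).1) (fun p hp => (hh p hp).2)⟩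
  have hs1 : 1 < Real.sqrt x := by rw [Real.lt_sqrt] <;> norm_num; exact hx
  have hBs : (B : ℝ) ≤ Real.sqrt x := Nat.floor_le (Real.sqrt_nonneg x)
  have hB1 : 1 ≤ B := Nat.le_floor (by exact_mod_cast hs1.le)
  have hBR : (1 : ℝ) ≤ B := by exact_mod_cast hB1
  have hB2 : Real.sqrt x ≤ 2 * B := by
    have := Nat.lt_floor_add_one (Real.sqrt x)
    linarith
  have hxs : Real.sqrt x * Real.sqrt x = x := Real.mul_self_sqrt (by linarith)
  have e : ∑ b ∈ Finset.Icc 1 B, muc (2 * m) b * (cntNP (a % 4) P (x / (b : ℝ) ^ 2) : ℝ) - x / 4 * Q * Z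
      = ∑ b ∈ Finset.Icc 1 B, muc (2 * m) b * ((cntNP (a % 4) P (x / (b : ℝ) ^ 2) : ℝ) - x / (b : ℝ) ^ 2 / 4 * Q)
        + x / 4 * Q * (∑ b ∈ Finset.Icc 1 B, muc (2 * m) b / (b : ℝ) ^ 2 - Z) := by
    rw [mul_sub, Finset.mul_sum, ← add_sub_assoc, ← Finset.sum_add_distrib]
    congr 1
    apply Finset.sum_congr rfl
    intros; ring
  rw [e]
  refine (abs_add_le _ _).trans (add_le_add ?_ ?_)
  · refine (Finset.abs_sum_le_sum_abs _ _).trans ?_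
    calc _ ≤ ∑ b ∈ Finset.Icc 1 B, (2 : ℝ) ^ m.primeFactors.card := by
          apply Finset.sum_le_sum
          intro b _
          rw [abs_mul]
          have h1 := cntNP_bound P hPp (a % 4) (by omega) (x / (b : ℝ) ^ 2) (by positivity)
          have h2 : (2 : ℝ) ^ P.card ≤ 2 ^ m.primeFactors.card :=
            pow_le_pow_right₀ (by norm_num) hPc
          calc _ ≤ 1 * (2 : ℝ) ^ m.primeFactors.card :=
                mul_le_mul (muc_abs _ _) (h1.trans h2) (abs_nonneg _) (by norm_num)
            _ = _ := one_mul _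
      _ = B * (2 : ℝ) ^ m.primeFactors.card := by simp
      _ ≤ _ := by gcongr
  · rw [abs_mul, abs_of_nonneg (by have := hQ0.1; positivity)]
    have ht := muc_tail (2 * m) B (by omega) hB1
    calc _ ≤ x / 4 * 1 * (1 / B) := by
          apply mul_le_mul _ ht (abs_nonneg _) (by positivity)
          gcongr; exact hQ0.2
      _ ≤ Real.sqrt x / 2 := by
          rw [mul_one, mul_one_div, div_le_iff₀ (by linarith)]
          nlinarith


/-- **Lemma (counting squarefree integers coprime to m in a residue class mod 4,
Lemma LemmaCountCoprSqf).**
There is an absolute constant `C > 0` such that for every odd residue class `a`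
modulo `4`, every integer `m ≥ 2` and every real `x > 1`, the number of squarefree
positive integers `d ≤ x` coprime to `m` with `d ≡ a (mod 4)` differs from
`x / (2 ζ(2) ∏_{p | 2m} (1 + 1/p))` by at most `C · x^(1/2) m^(1/4) (log m)^(1/2)`. -/
theorem counting_squarefree_coprime_residue :
    ∃ C : ℝ, 0 < C ∧ ∀ (a m : ℕ) (x : ℝ), Odd a → 2 ≤ m → 1 < x →
      |({d : ℕ | 0 < d ∧ (d : ℝ) ≤ x ∧ Squarefree d ∧ Nat.Coprime d m ∧
            d % 4 = a % 4}.ncard : ℝ)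
          - x / (2 * (Real.pi ^ 2 / 6) * ∏ p ∈ (2 * m).primeFactors, (1 + 1 / (p : ℝ)))|
        ≤ C * x ^ ((1 : ℝ) / 2) * (m : ℝ) ^ ((1 : ℝ) / 4) *
            (Real.log m) ^ ((1 : ℝ) / 2) := by
  refine ⟨2 ^ 18, by norm_num, ?_⟩
  intro a m x ha hm hx
  refine (main_bound a m x ha hm hx).trans ?_
  rw [← Real.sqrt_eq_rpow, ← Real.sqrt_eq_rpow]
  have h1 := two_pow_omega m (by omega)
  have hm' : (2 : ℝ) ≤ m := by exact_mod_cast hm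
  have h2 : 1 / 2 ≤ Real.sqrt (Real.log m) := by
    apply Real.le_sqrt_of_sq_le
    have := Real.log_two_gt_d9
    have := Real.log_le_log (by norm_num) hm'
    norm_num at *; linarith
  have h3 : 1 ≤ (m : ℝ) ^ ((1 : ℝ) / 4) := Real.one_le_rpow (by linarith) (by norm_num)
  have hs := Real.sqrt_nonneg x
  set s := Real.sqrt x
  set u := (m : ℝ) ^ ((1 : ℝ) / 4)
  calc s * 2 ^ m.primeFactors.card + s / 2 ≤ s * (2 ^ 16 * u) + s * (1 / 2) := by
        have := mul_le_mul_of_nonneg_left h1 hs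
        linarith
    _ ≤ 2 ^ 18 * s * u * (1 / 2) := by nlinarith [mul_le_mul_of_nonneg_left h3 hs]
    _ ≤ _ := by gcongr
end
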